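/- arXiv:1007.1491 — 4 statements merged into one kernel-verified Lean document; each statement's English description precedes it below -/
import Mathlib

section
/- Let α ≥ 0 and β ∈ ℝ satisfy 1 < β − 2α < 2, and let φ₀ be an odd Schwartz function on ℝ (φ₀(−x) = −φ₀(x)). Then the solution φ of i φ_t = (−Δ)^{β/2} φ in ℝ^{1+1} with φ(·,0) = φ₀ satisfies the identity ∫_{−∞}^{∞} ∫_{−∞}^{∞} | |∇|^α φ(x,t) |² / |x|^{β−2α} dx dt = [ 2^{β−2α} Γ(2−β+2α) sin( (2−β+2α)π/2 ) / ( β (β−1−2α) ) ] ‖φ₀‖_{L²(ℝ)}². -/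
open MeasureTheory Real SchwartzMap

noncomputable section

/-- The Fourier transform `φ̂₀(ξ) = ∫ e^{-i x ξ} φ₀(x) dx` on `ℝ`. -/
def fourierInt1 (f : ℝ → ℂ) (ξ : ℝ) : ℂ :=
  ∫ x : ℝ, Complex.exp (-(Complex.I * ((x * ξ : ℝ) : ℂ))) * f x

/-- `|∇|^α φ(x,t) = (2π)^{-1} ∫ |ξ|^α e^{i x ξ} e^{-i t |ξ|^β} φ̂₀(ξ) dξ`, where `φ` is the
solution of `i φ_t = (-Δ)^{β/2} φ` on `ℝ^{1+1}` with initial data `φ₀`. -/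
def gradProp1 (α β : ℝ) (φ₀ : 𝓢(ℝ, ℂ)) (x t : ℝ) : ℂ :=
  ((2 * π : ℝ))⁻¹ *
    ∫ ξ : ℝ,
      ((|ξ| ^ α : ℝ) : ℂ) * Complex.exp (Complex.I * ((x * ξ : ℝ) : ℂ)) *
        Complex.exp (-(Complex.I * (t : ℂ) * ((|ξ| ^ β : ℝ) : ℂ))) *
          fourierInt1 (fun y => φ₀ y) ξ

end

open Set FourierTransform
open scoped ContDiff

theorem aux_plancherel (f : ℝ → ℂ) (h1 : Integrable f) (h2 : MemLp f 2) :
    MemLp (𝓕 f) 2 ∧ ∫ t, ‖𝓕 f t‖ ^ 2 = ∫ x, ‖f x‖ ^ 2 := by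
  set F : Lp ℂ 2 (volume : Measure ℝ) := h2.toLp f with hF
  have hFf : F =ᵐ[volume] f := h2.coeFn_toLp
  have hcont : Continuous (𝓕 f) := by
    exact VectorFourier.fourierIntegral_continuous Real.continuous_fourierChar
      (by exact continuous_inner) h1
  have key : ∀ᵐ x, 𝓕 f x = (𝓕 F : Lp ℂ 2 (volume : Measure ℝ)) x := by
    apply ae_eq_of_integral_contDiff_smul_eq
    · exact hcont.locallyIntegrable
    · exact (Lp.memLp _).locallyIntegrable (by norm_num)
    · intro g hg hgc
      have hgc' : HasCompactSupport (fun x => (g x : ℂ)) :=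
        hgc.comp_left (g := fun x : ℝ => (x:ℂ)) (by simp)
      let ψ : 𝓢(ℝ, ℂ) := hgc'.toSchwartzMap (Complex.ofRealCLM.contDiff.comp hg)
      have hψ : ∀ x, ψ x = g x := fun x => rfl
      have e := congrArg (fun T => T ψ) (Lp.fourier_toTemperedDistribution_eq F)
      simp only [TemperedDistribution.fourier_apply, Lp.toTemperedDistribution_apply] at e
      have e2 := VectorFourier.integral_fourierIntegral_smul_eq_flip (L := innerₗ ℝ)
        Real.continuous_fourierChar (by exact continuous_inner) (ψ.integrable (μ := volume)) h1
      rw [flip_innerₗ] at e2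
      have e3 : ∫ x, (𝓕 ψ) x • F x = ∫ x, (𝓕 ψ) x • f x := by
        apply integral_congr_ae
        filter_upwards [hFf] with x hx
        rw [hx]
      have e4 : ∫ x, (𝓕 ψ) x • f x = ∫ x, ψ x • 𝓕 f x := e2
      rw [e3, e4] at e
      simpa [hψ] using e
  have hm : MemLp (𝓕 f) 2 := (Lp.memLp (𝓕 F)).ae_eq (by filter_upwards [key] with x hx; exact hx.symm)
  refine ⟨hm, ?_⟩
  have n1 : ∀ G : Lp ℂ 2 (volume : Measure ℝ), ‖G‖ ^ 2 = ∫ x, ‖G x‖ ^ 2 := by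
    intro G
    have := @L2.inner_def ℝ ℂ ℂ _ _ _ _ _ G G
    have h := congrArg Complex.re this
    rw [inner_self_eq_norm_sq_to_K] at h
    have h2 : ∫ x, inner ℂ (G x) (G x) = ((∫ x, ‖G x‖ ^ 2 : ℝ) : ℂ) := by
      rw [← integral_complex_ofReal]
      congr 1; ext x
      rw [inner_self_eq_norm_sq_to_K]; simp
    rw [h2] at h
    simp only [Complex.ofReal_re] at h
    rw [← h]
    norm_cast
  calc ∫ t, ‖𝓕 f t‖ ^ 2 = ∫ t, ‖(𝓕 F : Lp ℂ 2 (volume : Measure ℝ)) t‖ ^ 2 := by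
        apply integral_congr_ae
        filter_upwards [key] with x hx
        rw [hx]
    _ = ∫ t, ‖F t‖ ^ 2 := by rw [← n1, ← n1, Lp.norm_fourier_eq]
    _ = _ := by
        apply integral_congr_ae
        filter_upwards [hFf] with x hx
        rw [hx]

theorem aux_tonelli {μ ν : Measure ℝ} [SFinite μ] [SFinite ν] (f : ℝ → ℝ → ℝ)
    (hm : AEStronglyMeasurable (Function.uncurry f) (μ.prod ν))
    (h0 : ∀ᵐ x ∂μ, ∀ᵐ y ∂ν, 0 ≤ f x y) (F : ℝ → ℝ)
    (hF : ∀ᵐ x ∂μ, Integrable (f x) ν ∧ ∫ y, f x y ∂ν = F x) (hFi : Integrable F μ) :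
    Integrable (fun y => ∫ x, f x y ∂μ) ν ∧ ∫ y, ∫ x, f x y ∂μ ∂ν = ∫ x, F x ∂μ := by
  have hi : Integrable (Function.uncurry f) (μ.prod ν) := by
    rw [integrable_prod_iff hm]
    refine ⟨hF.mono fun x hx => hx.1, hFi.congr ?_⟩
    filter_upwards [h0, hF] with x hx hx2
    rw [← hx2.2]
    apply integral_congr_ae
    filter_upwards [hx] with y hy
    simp [Function.uncurry, abs_of_nonneg hy]
  refine ⟨hi.integral_prod_right, ?_⟩
  rw [← integral_integral_swap hi]
  exact integral_congr_ae (hF.mono fun x hx => hx.2)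

theorem aux_sin_exp (s : ℝ) (hs : 0 < s) :
    IntegrableOn (fun u : ℝ => Real.sin u ^ 2 * Real.exp (-(s * u))) (Ioi 0) ∧
    ∫ u in Ioi (0:ℝ), Real.sin u ^ 2 * Real.exp (-(s * u)) = 2 / (s * (s ^ 2 + 4)) := by
  have ha : ((-s : ℂ) + 2 * Complex.I).re < 0 := by simp [hs]
  have i1 := integrableOn_exp_mul_complex_Ioi ha 0
  have v1 := integral_exp_mul_complex_Ioi ha 0
  have i2 := integrableOn_exp_mul_Ioi (neg_lt_zero.2 hs) 0
  have v2 := integral_exp_mul_Ioi (neg_lt_zero.2 hs) 0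
  have i1r : IntegrableOn (fun x : ℝ => (Complex.exp (((-s : ℂ) + 2 * Complex.I) * x)).re) (Ioi 0) := i1.re
  have hre : ∫ x in Ioi (0:ℝ), (Complex.exp (((-s : ℂ) + 2 * Complex.I) * x)).re
      = s / (s ^ 2 + 4) := by
    have := integral_re i1
    simp only [RCLike.re_to_complex] at this
    rw [this, v1]
    simp [Complex.div_re, Complex.normSq_apply]
    field_simp
    ring
  have hpt : ∀ u : ℝ, Real.sin u ^ 2 * Real.exp (-(s * u)) =
      2⁻¹ * (Real.exp (-s * u) - (Complex.exp (((-s : ℂ) + 2 * Complex.I) * u)).re) := by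
    intro u
    rw [Complex.exp_re]
    simp
    rw [Real.cos_two_mul, Real.sin_sq]
    ring
  simp_rw [hpt]
  refine ⟨(i2.sub i1r).const_mul _, ?_⟩
  rw [integral_const_mul, integral_sub i2 i1r, hre, v2]
  simp
  field_simp
  ring

theorem aux_beta (γ : ℝ) (h1 : 1 < γ) (h2 : γ < 2) :
    IntegrableOn (fun s : ℝ => s ^ (γ - 2) * (s ^ 2 + 4)⁻¹) (Ioi 0) ∧
    ∫ s in Ioi (0:ℝ), s ^ (γ - 2) * (s ^ 2 + 4)⁻¹ =
      2⁻¹ * (1 / 4) ^ (1 - (γ - 1) / 2) * (Real.Gamma ((γ - 1) / 2) * Real.Gamma (1 - (γ - 1) / 2)) := by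
  have T := aux_tonelli (μ := volume.restrict (Ioi 0)) (ν := volume.restrict (Ioi 0))
    (fun w s => s ^ (γ - 2) * Real.exp (-((s ^ 2 + 4) * w)))
    (by
      apply Measurable.aestronglyMeasurable
      unfold Function.uncurry
      fun_prop)
    (by
      refine Filter.Eventually.of_forall fun w => ?_
      filter_upwards [ae_restrict_mem measurableSet_Ioi] with s hs
      have : (0:ℝ) < s := hs
      positivity)
    (fun w => (2⁻¹ * Real.Gamma ((γ - 1) / 2)) * (w ^ ((1 - (γ - 1) / 2) - 1) * Real.exp (-(4 * w))))
    (by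
      filter_upwards [ae_restrict_mem measurableSet_Ioi] with w hw
      have hw' : (0:ℝ) < w := hw
      have hpt : ∀ s : ℝ, s ^ (γ - 2) * Real.exp (-((s ^ 2 + 4) * w)) =
          Real.exp (-(4 * w)) * (s ^ (γ - 2) * Real.exp (- w * s ^ (2:ℝ))) := by
        intro s
        rw [Real.rpow_two, mul_left_comm, ← Real.exp_add]
        ring_nf
      simp_rw [hpt]
      refine ⟨(integrableOn_rpow_mul_exp_neg_mul_rpow (by linarith) (by norm_num) hw').const_mul _, ?_⟩
      rw [integral_const_mul, integral_rpow_mul_exp_neg_mul_rpow (by norm_num) (by linarith) hw']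
      rw [show -(γ - 2 + 1) / 2 = (1 - (γ - 1) / 2) - 1 by ring,
        show (γ - 2 + 1) / 2 = (γ - 1) / 2 by ring]
      ring)
    (by
      apply Integrable.const_mul
      have := integrableOn_rpow_mul_exp_neg_mul_rpow (p := 1) (s := (1 - (γ - 1) / 2) - 1) (b := 4)
        (by linarith) one_pos (by norm_num)
      simpa [IntegrableOn] using this)
  have hin : ∀ s ∈ Ioi (0:ℝ), ∫ w in Ioi (0:ℝ), s ^ (γ - 2) * Real.exp (-((s ^ 2 + 4) * w))
      = s ^ (γ - 2) * (s ^ 2 + 4)⁻¹ := by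
    intro s hs
    rw [integral_const_mul]
    have v2 := integral_exp_mul_Ioi (a := -(s ^ 2 + 4)) (by nlinarith [sq_nonneg s]) 0
    simp only [neg_mul] at v2
    rw [v2]
    simp
    left
    rw [← neg_add, neg_div, div_neg, neg_neg, one_div, add_comm]
  refine ⟨?_, ?_⟩
  · have := T.1
    exact this.congr ((ae_restrict_mem measurableSet_Ioi).mono fun s hs => hin s hs)
  · rw [← setIntegral_congr_fun measurableSet_Ioi hin]
    rw [T.2, integral_const_mul, integral_rpow_mul_exp_neg_mul_Ioi (by linarith) (by norm_num)]
    ring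

theorem aux_sin_int (γ : ℝ) (h1 : 1 < γ) (h2 : γ < 2) :
    IntegrableOn (fun u : ℝ => Real.sin u ^ 2 * u ^ (-γ)) (Ioi 0) ∧
    ∫ u in Ioi (0:ℝ), Real.sin u ^ 2 * u ^ (-γ) =
      2 ^ (γ - 2) * Real.Gamma (2 - γ) * Real.sin ((2 - γ) / 2 * π) / (γ - 1) := by
  have hG : 0 < Real.Gamma γ := Real.Gamma_pos_of_pos (by linarith)
  have T := aux_tonelli (μ := volume.restrict (Ioi 0)) (ν := volume.restrict (Ioi 0))
    (fun s u => s ^ (γ - 1) * (Real.sin u ^ 2 * Real.exp (-(s * u))))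
    (by
      apply Measurable.aestronglyMeasurable
      unfold Function.uncurry
      fun_prop)
    (by
      filter_upwards [ae_restrict_mem measurableSet_Ioi] with s hs
      refine Filter.Eventually.of_forall fun w => ?_
      have : (0:ℝ) < s := hs
      positivity)
    (fun s => 2 * (s ^ (γ - 2) * (s ^ 2 + 4)⁻¹))
    (by
      filter_upwards [ae_restrict_mem measurableSet_Ioi] with s hs
      have hs' : (0:ℝ) < s := hs
      obtain ⟨a, b⟩ := aux_sin_exp s hs'
      refine ⟨a.const_mul _, ?_⟩
      rw [integral_const_mul, b, show γ - 1 = γ - 2 + 1 by ring, Real.rpow_add_one hs'.ne']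
      field_simp)
    ((aux_beta γ h1 h2).1.const_mul _)
  have hin : ∀ u ∈ Ioi (0:ℝ), (Real.Gamma γ)⁻¹ *
      ∫ s in Ioi (0:ℝ), s ^ (γ - 1) * (Real.sin u ^ 2 * Real.exp (-(s * u)))
      = Real.sin u ^ 2 * u ^ (-γ) := by
    intro u hu
    have hu' : (0:ℝ) < u := hu
    have : ∀ s : ℝ, s ^ (γ - 1) * (Real.sin u ^ 2 * Real.exp (-(s * u))) =
      Real.sin u ^ 2 * (s ^ (γ - 1) * Real.exp (-(u * s))) := by intro s; ring_nf
    simp_rw [this]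
    rw [integral_const_mul, integral_rpow_mul_exp_neg_mul_Ioi (by linarith) hu', one_div,
      Real.inv_rpow hu'.le, Real.rpow_neg hu'.le]
    field_simp
  refine ⟨?_, ?_⟩
  · have := T.1.const_mul (Real.Gamma γ)⁻¹
    exact this.congr ((ae_restrict_mem measurableSet_Ioi).mono fun s hs => hin s hs)
  · rw [← setIntegral_congr_fun measurableSet_Ioi hin]
    rw [integral_const_mul, T.2, integral_const_mul, (aux_beta γ h1 h2).2,
      Real.Gamma_mul_Gamma_one_sub]
    have e1 := Real.Gamma_mul_Gamma_one_sub γ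
    have e2 : Real.Gamma (2 - γ) = (1 - γ) * Real.Gamma (1 - γ) := by
      rw [← Real.Gamma_add_one (by linarith)]; ring_nf
    have e3 : Real.sin (π * ((γ - 1) / 2)) = - Real.cos (π * γ / 2) := by
      rw [show π * ((γ - 1) / 2) = π * γ / 2 - π / 2 by ring, Real.sin_sub_pi_div_two]
    have e4 : Real.sin ((2 - γ) / 2 * π) = Real.sin (π * γ / 2) := by
      rw [show (2 - γ) / 2 * π = π - π * γ / 2 by ring, Real.sin_pi_sub]
    have e5 : Real.sin (π * γ) = 2 * Real.sin (π * γ / 2) * Real.cos (π * γ / 2) := by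
      rw [← Real.sin_two_mul]; ring_nf
    have c0 : Real.cos (π * γ / 2) < 0 := by
      apply Real.cos_neg_of_pi_div_two_lt_of_lt <;> nlinarith [Real.pi_pos]
    have s0 : 0 < Real.sin (π * γ / 2) := by
      apply Real.sin_pos_of_pos_of_lt_pi <;> nlinarith [Real.pi_pos]
    have e6 : ((1:ℝ) / 4) ^ (1 - (γ - 1) / 2) = 2 ^ (γ - 2) / 2 := by
      rw [show (1:ℝ) / 4 = 2 ^ (-2 : ℝ) by rw [Real.rpow_neg (by norm_num)]; norm_num,
        ← Real.rpow_mul (by norm_num), ← Real.rpow_sub_one (by norm_num)]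
      ring_nf
    have e7 : Real.Gamma (1 - γ) = π / Real.sin (π * γ) / Real.Gamma γ := by
      rw [← e1]; field_simp
    rw [e6, e3, e4, e2, e7, e5]
    have hg1 : γ - 1 ≠ 0 := by linarith
    have c1 := c0.ne
    have s1 := s0.ne'
    clear e1 e3 e4 e5 e6 e7 T hin c0 s0
    generalize Real.cos (π * γ / 2) = c at *
    generalize Real.sin (π * γ / 2) = d at *
    field_simp
    ring

theorem aux_subst (β : ℝ) (hβ : 0 < β) (q : ℝ → ℂ) (hm : Measurable q)
    (hq : IntegrableOn q (Ioi 0))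
    (hq2 : IntegrableOn (fun ξ : ℝ => ξ ^ (1 - β) * ‖q ξ‖ ^ 2) (Ioi 0)) :
    Integrable (fun t : ℝ => ‖∫ ξ in Ioi (0:ℝ),
      Complex.exp (-(Complex.I * (t : ℂ) * ((ξ ^ β : ℝ) : ℂ))) * q ξ‖ ^ 2) ∧
    ∫ t : ℝ, ‖∫ ξ in Ioi (0:ℝ),
      Complex.exp (-(Complex.I * (t : ℂ) * ((ξ ^ β : ℝ) : ℂ))) * q ξ‖ ^ 2
      = 2 * π / β * ∫ ξ in Ioi (0:ℝ), ξ ^ (1 - β) * ‖q ξ‖ ^ 2 := by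
  set h0 : ℝ → ℂ := fun l => ((β⁻¹ * (l ^ β⁻¹) ^ (1 - β) : ℝ) : ℂ) * q (l ^ β⁻¹) with hh0
  have hinv : ∀ ξ ∈ Ioi (0:ℝ), (ξ ^ β) ^ β⁻¹ = ξ := by
    intro ξ hξ
    rw [← Real.rpow_mul (le_of_lt hξ), mul_inv_cancel₀ hβ.ne', Real.rpow_one]
  have hone : ∀ ξ ∈ Ioi (0:ℝ), ξ ^ (β - 1) * ξ ^ (1 - β) = 1 := by
    intro ξ hξ
    rw [← Real.rpow_add hξ]; simp
  have hkey : ∀ ξ ∈ Ioi (0:ℝ), (β * ξ ^ (β - 1)) • h0 (ξ ^ β) = q ξ := by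
    intro ξ hξ
    simp only [hh0, hinv ξ hξ]
    rw [Complex.real_smul, ← mul_assoc, ← Complex.ofReal_mul,
      show β * ξ ^ (β - 1) * (β⁻¹ * ξ ^ (1 - β)) = (β * β⁻¹) * (ξ ^ (β - 1) * ξ ^ (1 - β)) by ring,
      hone ξ hξ, mul_inv_cancel₀ hβ.ne']
    simp
  have hkey2 : ∀ ξ ∈ Ioi (0:ℝ), (β * ξ ^ (β - 1)) • ‖h0 (ξ ^ β)‖ ^ 2
      = β⁻¹ * (ξ ^ (1 - β) * ‖q ξ‖ ^ 2) := by
    intro ξ hξ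
    have hp : (0:ℝ) < ξ := hξ
    simp only [hh0, hinv ξ hξ]
    rw [norm_mul, Complex.norm_real, Real.norm_of_nonneg (by positivity), smul_eq_mul,
      show β * ξ ^ (β - 1) * (β⁻¹ * ξ ^ (1 - β) * ‖q ξ‖) ^ 2
        = (β * β⁻¹) * β⁻¹ * (ξ ^ (β - 1) * ξ ^ (1 - β)) * (ξ ^ (1 - β) * ‖q ξ‖ ^ 2) by ring,
      hone ξ hξ, mul_inv_cancel₀ hβ.ne']
    simp
  have hm0 : Measurable h0 := by
    have : Measurable (fun l : ℝ => q (l ^ β⁻¹)) := hm.comp (by fun_prop)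
    fun_prop
  have i1 : IntegrableOn h0 (Ioi 0) := by
    rw [← integrableOn_Ioi_comp_rpow_iff h0 hβ.ne', abs_of_pos hβ]
    exact hq.congr_fun (fun ξ hξ => (hkey ξ hξ).symm) measurableSet_Ioi
  have i2 : IntegrableOn (fun l => ‖h0 l‖ ^ 2) (Ioi 0) := by
    rw [← integrableOn_Ioi_comp_rpow_iff (fun l => ‖h0 l‖ ^ 2) hβ.ne', abs_of_pos hβ]
    exact IntegrableOn.congr_fun (hq2.const_mul β⁻¹) (fun ξ hξ => (hkey2 ξ hξ).symm) measurableSet_Ioi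
  set h : ℝ → ℂ := (Ioi (0:ℝ)).indicator h0 with hh
  have hhm : Measurable h := hm0.indicator measurableSet_Ioi
  have j1 : Integrable h := i1.integrable_indicator measurableSet_Ioi
  have hnorm : (fun l => ‖h l‖ ^ 2) = (Ioi (0:ℝ)).indicator (fun l => ‖h0 l‖ ^ 2) := by
    ext l
    by_cases hl : l ∈ Ioi (0:ℝ) <;> simp [hh, hl]
  have j2 : MemLp h 2 := by
    rw [memLp_two_iff_integrable_sq_norm hhm.aestronglyMeasurable, hnorm]
    exact i2.integrable_indicator measurableSet_Ioi
  obtain ⟨P1, P2⟩ := aux_plancherel h j1 j2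
  have hU : ∀ t : ℝ, ∫ ξ in Ioi (0:ℝ),
      Complex.exp (-(Complex.I * (t : ℂ) * ((ξ ^ β : ℝ) : ℂ))) * q ξ = 𝓕 h (t / (2 * π)) := by
    intro t
    rw [Real.fourier_real_eq_integral_exp_smul]
    have : ∀ v : ℝ, Complex.exp (↑(-2 * π * v * (t / (2 * π))) * Complex.I) • h v =
       (Ioi (0:ℝ)).indicator (fun l : ℝ => Complex.exp (-(Complex.I * (t : ℂ) * (l:ℂ))) * h0 l) v := by
      intro v
      have e : (-2 * π * v * (t / (2 * π)) : ℝ) = - (t * v) := by field_simp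
      by_cases hl : v ∈ Ioi (0:ℝ)
      · simp only [hh, indicator_of_mem hl, smul_eq_mul, e]
        push_cast; ring_nf
      · simp [hh, hl]
    simp_rw [this]
    rw [integral_indicator measurableSet_Ioi, ← integral_comp_rpow_Ioi_of_pos
      (g := fun l : ℝ => Complex.exp (-(Complex.I * (t : ℂ) * (l:ℂ))) * h0 l) hβ]
    refine setIntegral_congr_fun measurableSet_Ioi fun ξ hξ => ?_
    rw [← mul_smul_comm, hkey ξ hξ]
  simp_rw [hU]
  have hi : Integrable (fun t => ‖𝓕 h t‖ ^ 2) :=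
    (memLp_two_iff_integrable_sq_norm P1.1).1 P1
  refine ⟨hi.comp_div (by positivity), ?_⟩
  rw [Measure.integral_comp_div (fun t => ‖𝓕 h t‖ ^ 2), P2, hnorm,
    integral_indicator measurableSet_Ioi, ← integral_comp_rpow_Ioi_of_pos hβ,
    setIntegral_congr_fun measurableSet_Ioi hkey2, integral_const_mul, abs_of_pos (by positivity)]
  simp only [smul_eq_mul]
  ring

theorem aux_half (f : ℝ → ℂ) (hf : Integrable f) :
    ∫ x, f x = ∫ x in Ioi (0:ℝ), (f x + f (-x)) := by
  rw [integral_add hf.integrableOn hf.comp_neg.integrableOn, integral_comp_neg_Ioi, neg_zero,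
    add_comm, intervalIntegral.integral_Iic_add_Ioi hf.integrableOn hf.integrableOn]

theorem aux_even (f : ℝ → ℝ) (he : ∀ x, f (-x) = f x) (h : IntegrableOn f (Ioi 0)) :
    Integrable f ∧ ∫ x, f x = 2 * ∫ x in Ioi (0:ℝ), f x := by
  have h' : IntegrableOn f (Iic 0) := by
    rw [integrableOn_Iic_iff_integrableOn_Iio]
    have := IntegrableOn.comp_neg_Iio (c := 0) (f := f) (by simpa using h)
    simpa [he] using this
  have hi : Integrable f := by
    rw [← integrableOn_univ, ← Iic_union_Ioi (a := (0:ℝ))]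
    exact h'.union h
  refine ⟨hi, ?_⟩
  rw [← intervalIntegral.integral_Iic_add_Ioi h' h, two_mul]
  congr 1
  have := integral_comp_neg_Ioi 0 f
  simp only [he, neg_zero] at this
  exact this.symm

theorem aux_sin_line (γ : ℝ) (h1 : 1 < γ) (h2 : γ < 2) (ξ : ℝ) (hξ : 0 < ξ) :
    Integrable (fun x : ℝ => Real.sin (x * ξ) ^ 2 / |x| ^ γ) ∧
    ∫ x : ℝ, Real.sin (x * ξ) ^ 2 / |x| ^ γ = ξ ^ (γ - 1) *
      (2 * (2 ^ (γ - 2) * Real.Gamma (2 - γ) * Real.sin ((2 - γ) / 2 * π) / (γ - 1))) := by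
  obtain ⟨a, b⟩ := aux_sin_int γ h1 h2
  have hpt : ∀ x ∈ Ioi (0:ℝ), ξ ^ γ * (Real.sin (ξ * x) ^ 2 * (ξ * x) ^ (-γ)) =
      Real.sin (x * ξ) ^ 2 / |x| ^ γ := by
    intro x hx
    have hx' : (0:ℝ) < x := hx
    rw [abs_of_pos hx', Real.mul_rpow hξ.le hx'.le, Real.rpow_neg hξ.le, Real.rpow_neg hx'.le,
      mul_comm ξ x]
    have := (Real.rpow_pos_of_pos hξ γ).ne'
    field_simp
  have i : IntegrableOn (fun x : ℝ => Real.sin (x * ξ) ^ 2 / |x| ^ γ) (Ioi 0) := by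
    have := (integrableOn_Ioi_comp_mul_left_iff (fun u : ℝ => Real.sin u ^ 2 * u ^ (-γ)) 0 hξ).2
      (by simpa using a)
    exact IntegrableOn.congr_fun (this.const_mul (ξ ^ γ)) hpt measurableSet_Ioi
  obtain ⟨A, B⟩ := aux_even _ (by intro x; simp) i
  refine ⟨A, ?_⟩
  rw [B, ← setIntegral_congr_fun measurableSet_Ioi hpt, integral_const_mul,
    integral_comp_mul_left_Ioi (fun u : ℝ => Real.sin u ^ 2 * u ^ (-γ)) 0 hξ, mul_zero, b,
    Real.rpow_sub_one hξ.ne', smul_eq_mul]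
  ring

theorem aux_fourier (φ₀ : 𝓢(ℝ, ℂ)) (ξ : ℝ) :
    fourierInt1 (fun y => φ₀ y) ξ = (𝓕 φ₀) (ξ / (2 * π)) := by
  rw [fourier_coe, Real.fourier_real_eq_integral_exp_smul, fourierInt1]
  congr 1
  ext x
  have e : (-2 * π * x * (ξ / (2 * π)) : ℝ) = - (x * ξ) := by field_simp
  rw [e, smul_eq_mul]
  push_cast
  ring_nf

theorem aux_g (φ₀ : 𝓢(ℝ, ℂ)) (hodd : ∀ x : ℝ, φ₀ (-x) = -φ₀ x) :
    Continuous (fourierInt1 (fun y => φ₀ y)) ∧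
    (∀ ξ, fourierInt1 (fun y => φ₀ y) (-ξ) = - fourierInt1 (fun y => φ₀ y) ξ) ∧
    (∃ C, ∀ ξ, ‖fourierInt1 (fun y => φ₀ y) ξ‖ ≤ C) ∧
    (∀ a : ℝ, 0 ≤ a → Integrable (fun ξ : ℝ => |ξ| ^ a * ‖fourierInt1 (fun y => φ₀ y) ξ‖)) ∧
    IntegrableOn (fun ξ : ℝ => ‖fourierInt1 (fun y => φ₀ y) ξ‖ ^ 2) (Ioi 0) ∧
    ∫ ξ in Ioi (0:ℝ), ‖fourierInt1 (fun y => φ₀ y) ξ‖ ^ 2 = π * ∫ x : ℝ, ‖φ₀ x‖ ^ 2 := by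
  set g := fourierInt1 (fun y => φ₀ y) with hg
  have hgf : g = fun ξ => (𝓕 φ₀) (ξ / (2 * π)) := funext fun ξ => aux_fourier φ₀ ξ
  have hc : Continuous g := by
    rw [hgf]
    exact (𝓕 φ₀).continuous.comp (by fun_prop)
  have ho : ∀ ξ, g (-ξ) = - g ξ := by
    intro ξ
    simp only [hg, fourierInt1]
    rw [← integral_neg_eq_self, ← integral_neg]
    congr 1; ext x
    rw [hodd]
    simp
  obtain ⟨C, hC⟩ : ∃ C, ∀ ξ, ‖g ξ‖ ≤ C := by
    obtain ⟨C, hC⟩ := (𝓕 φ₀).decay 0 0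
    refine ⟨C, fun ξ => ?_⟩
    have := hC.2 (ξ / (2 * π))
    rw [hgf]
    simpa using this
  have hpow : ∀ k : ℕ, Integrable (fun ξ : ℝ => |ξ| ^ k * ‖g ξ‖) := by
    intro k
    have := ((𝓕 φ₀).integrable_pow_mul volume k).comp_div (R := 2 * π) (by positivity)
    refine (this.const_mul ((2 * π) ^ k)).congr (Filter.Eventually.of_forall fun ξ => ?_)
    simp only [hgf, Real.norm_eq_abs, abs_div, abs_of_pos Real.two_pi_pos, div_pow]
    field_simp
  have ha : ∀ a : ℝ, 0 ≤ a → Integrable (fun ξ : ℝ => |ξ| ^ a * ‖g ξ‖) := by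
    intro a ha
    obtain ⟨k, hk⟩ := exists_nat_ge a
    refine ((hpow 0).add (hpow k)).mono' ?_ (Filter.Eventually.of_forall fun ξ => ?_)
    · apply Measurable.aestronglyMeasurable
      have := hc.measurable
      fun_prop
    · rw [Real.norm_of_nonneg (by positivity)]
      simp only [Pi.add_apply, ← add_mul]
      gcongr
      rcases le_total |ξ| 1 with h | h
      · have := Real.rpow_le_one (abs_nonneg ξ) h ha
        have : 0 ≤ |ξ| ^ k := by positivity
        simp; linarith
      · have := Real.rpow_le_rpow_of_exponent_le h hk
        rw [Real.rpow_natCast] at this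
        simp; linarith
  have hsq : Integrable (fun ξ : ℝ => ‖g ξ‖ ^ 2) := by
    refine ((hpow 0).const_mul C).mono' ?_ (Filter.Eventually.of_forall fun ξ => ?_)
    · exact (hc.norm.pow 2).aestronglyMeasurable
    · rw [Real.norm_of_nonneg (by positivity), sq]
      simp only [pow_zero, one_mul]
      gcongr
      exact hC ξ
  refine ⟨hc, ho, ⟨C, hC⟩, ha, hsq.integrableOn, ?_⟩
  obtain ⟨_, B⟩ := aux_even (fun ξ => ‖g ξ‖ ^ 2) (by intro x; simp [ho]) hsq.integrableOn
  have e : ∫ ξ, ‖g ξ‖ ^ 2 = 2 * π * ∫ x : ℝ, ‖φ₀ x‖ ^ 2 := by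
    rw [← SchwartzMap.integral_norm_sq_fourier, hgf]
    simp only
    rw [Measure.integral_comp_div (fun ξ : ℝ => ‖(𝓕 φ₀ : 𝓢(ℝ, ℂ)) ξ‖ ^ 2), abs_of_pos Real.two_pi_pos, smul_eq_mul]
  linarith

theorem aux_grad (α β : ℝ) (hα : 0 ≤ α) (φ₀ : 𝓢(ℝ, ℂ)) (hodd : ∀ x : ℝ, φ₀ (-x) = -φ₀ x)
    (x t : ℝ) :
    gradProp1 α β φ₀ x t = (Complex.I / (π : ℂ)) * ∫ ξ in Ioi (0:ℝ),
      Complex.exp (-(Complex.I * (t : ℂ) * ((ξ ^ β : ℝ) : ℂ))) *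
        (((ξ ^ α * Real.sin (x * ξ) : ℝ) : ℂ) * fourierInt1 (fun y => φ₀ y) ξ) := by
  obtain ⟨hc, ho, -, hint, -, -⟩ := aux_g φ₀ hodd
  set g := fourierInt1 (fun y => φ₀ y) with hg
  have hgm := hc.measurable
  rw [gradProp1, aux_half]
  · rw [← integral_const_mul, ← integral_const_mul]
    refine setIntegral_congr_fun measurableSet_Ioi fun ξ hξ => ?_
    have hξ' : (0:ℝ) < ξ := hξ
    simp only [← hg, abs_neg, abs_of_pos hξ', ho]
    have e : Complex.exp (Complex.I * ((x * ξ : ℝ) : ℂ)) -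
        Complex.exp (Complex.I * ((x * -ξ : ℝ) : ℂ)) = 2 * Complex.I * (Real.sin (x * ξ) : ℂ) := by
      rw [Complex.ofReal_sin, Complex.sin]
      push_cast
      have : ((x:ℂ) * ξ) * Complex.I = Complex.I * (x * ξ) := by ring
      have h2 : -((x:ℂ) * ξ) * Complex.I = Complex.I * (x * -ξ) := by ring
      rw [this, h2]
      linear_combination (-(Complex.exp (Complex.I * (x * -ξ)) - Complex.exp (Complex.I * (x * ξ)))) * Complex.I_sq
    have hpi : (π : ℂ) ≠ 0 := by exact_mod_cast Real.pi_ne_zero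
    calc _ = ((2 * π : ℝ) : ℂ)⁻¹ * (((ξ ^ α : ℝ) : ℂ) *
          Complex.exp (-(Complex.I * (t : ℂ) * ((ξ ^ β : ℝ) : ℂ))) * g ξ *
          (Complex.exp (Complex.I * ((x * ξ : ℝ) : ℂ)) -
            Complex.exp (Complex.I * ((x * -ξ : ℝ) : ℂ)))) := by push_cast; ring
      _ = _ := by
        rw [e]; push_cast; field_simp
  · refine (hint α hα).mono' ?_ (Filter.Eventually.of_forall fun ξ => ?_)
    · apply Measurable.aestronglyMeasurable
      rw [← hg]
      fun_prop
    · simp only [norm_mul, ← hg]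
      have e1 : ‖Complex.exp (Complex.I * ((x * ξ : ℝ) : ℂ))‖ = 1 := by
        rw [mul_comm]; exact Complex.norm_exp_ofReal_mul_I _
      have e2 : ‖Complex.exp (-(Complex.I * (t : ℂ) * ((|ξ| ^ β : ℝ) : ℂ)))‖ = 1 := by
        rw [show -(Complex.I * (t : ℂ) * ((|ξ| ^ β : ℝ) : ℂ)) = ((-(t * |ξ| ^ β) : ℝ) : ℂ) * Complex.I by
          push_cast; ring]
        exact Complex.norm_exp_ofReal_mul_I _
      rw [e1, e2, Complex.norm_real, Real.norm_of_nonneg (by positivity)]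
      simp

theorem aux_time (α β : ℝ) (hα : 0 ≤ α) (h1 : 1 < β - 2 * α) (h2 : β - 2 * α < 2)
    (φ₀ : 𝓢(ℝ, ℂ)) (hodd : ∀ x : ℝ, φ₀ (-x) = -φ₀ x) (x : ℝ) :
    Integrable (fun t => ‖gradProp1 α β φ₀ x t‖ ^ 2) ∧
    ∫ t, ‖gradProp1 α β φ₀ x t‖ ^ 2 = 2 / (π * β) * ∫ ξ in Ioi (0:ℝ),
      ξ ^ (1 - (β - 2 * α)) * ‖fourierInt1 (fun y => φ₀ y) ξ‖ ^ 2 * Real.sin (x * ξ) ^ 2 := by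
  obtain ⟨hc, ho, ⟨C, hC⟩, hint, -, -⟩ := aux_g φ₀ hodd
  have hgr := aux_grad α β hα φ₀ hodd x
  set g := fourierInt1 (fun y => φ₀ y) with hg
  have hgm := hc.measurable
  have hβ : 0 < β := by linarith
  have hpt : ∀ ξ ∈ Ioi (0:ℝ), ξ ^ (1 - β) * ‖((ξ ^ α * Real.sin (x * ξ) : ℝ) : ℂ) * g ξ‖ ^ 2 =
      ξ ^ (1 - (β - 2 * α)) * ‖g ξ‖ ^ 2 * Real.sin (x * ξ) ^ 2 := by
    intro ξ hξ
    have hξ' : (0:ℝ) < ξ := hξ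
    rw [norm_mul, Complex.norm_real, mul_pow, Real.norm_eq_abs, sq_abs,
      show 1 - (β - 2 * α) = 1 - β + α + α by ring, Real.rpow_add hξ', Real.rpow_add hξ']
    ring
  have S := aux_subst β hβ (fun ξ => ((ξ ^ α * Real.sin (x * ξ) : ℝ) : ℂ) * g ξ)
    (by fun_prop)
    (by
      refine (hint α hα).integrableOn.mono' ?_ ?_
      · apply Measurable.aestronglyMeasurable
        fun_prop
      · filter_upwards [ae_restrict_mem measurableSet_Ioi] with ξ hξ
        have hξ' : (0:ℝ) < ξ := hξ
        rw [norm_mul, Complex.norm_real, Real.norm_eq_abs, abs_mul, abs_of_pos hξ',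
          abs_of_pos (Real.rpow_pos_of_pos hξ' _)]
        gcongr
        exact mul_le_of_le_one_right (by positivity) (Real.abs_sin_le_one _))
    (by
      refine IntegrableOn.congr_fun ?_ (fun ξ hξ => (hpt ξ hξ).symm) measurableSet_Ioi
      refine ((hint (2 - (β - 2 * α)) (by linarith)).const_mul (|x| * C)).integrableOn.mono' ?_ ?_
      · apply Measurable.aestronglyMeasurable
        fun_prop
      · filter_upwards [ae_restrict_mem measurableSet_Ioi] with ξ hξ
        have hξ' : (0:ℝ) < ξ := hξ
        rw [Real.norm_of_nonneg (by positivity), abs_of_pos hξ',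
          show 2 - (β - 2 * α) = 1 - (β - 2 * α) + 1 by ring, Real.rpow_add_one hξ'.ne']
        have a1 : Real.sin (x * ξ) ^ 2 ≤ |x| * ξ := by
          have b1 := Real.abs_sin_le_one (x * ξ)
          have b2 : |Real.sin (x * ξ)| ≤ |x * ξ| := Real.abs_sin_le_abs
          rw [abs_mul, abs_of_pos hξ'] at b2
          rw [← sq_abs]
          nlinarith [abs_nonneg (Real.sin (x * ξ))]
        have a2 : ‖g ξ‖ ^ 2 ≤ C * ‖g ξ‖ := by
          rw [sq]; gcongr; exact hC ξ
        calc _ ≤ ξ ^ (1 - (β - 2 * α)) * (C * ‖g ξ‖) * (|x| * ξ) := by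
              gcongr
              exact mul_nonneg (Real.rpow_nonneg hξ'.le _)
                (mul_nonneg ((norm_nonneg _).trans (hC 0)) (norm_nonneg _))
          _ = _ := by ring)
  have hn : ∀ t, ‖gradProp1 α β φ₀ x t‖ ^ 2 = (π ^ 2)⁻¹ * ‖∫ ξ in Ioi (0:ℝ),
      Complex.exp (-(Complex.I * (t : ℂ) * ((ξ ^ β : ℝ) : ℂ))) *
        (((ξ ^ α * Real.sin (x * ξ) : ℝ) : ℂ) * g ξ)‖ ^ 2 := by
    intro t
    rw [hgr t, norm_mul, mul_pow]
    congr 1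
    simp
  simp_rw [hn]
  refine ⟨S.1.const_mul _, ?_⟩
  rw [integral_const_mul, S.2, setIntegral_congr_fun measurableSet_Ioi hpt]
  have := Real.pi_ne_zero
  field_simp


/-- Sharp Kato-type smoothing identity for odd data on `ℝ^{1+1}`, `1 < β - 2α < 2`. -/
theorem kato_identity_odd_data_1d (α β : ℝ) (hα : 0 ≤ α)
    (h1 : 1 < β - 2 * α) (h2 : β - 2 * α < 2)
    (φ₀ : SchwartzMap ℝ ℂ) (hodd : ∀ x : ℝ, φ₀ (-x) = -φ₀ x) :
    (∫ t : ℝ, ∫ x : ℝ, ‖gradProp1 α β φ₀ x t‖ ^ 2 / |x| ^ (β - 2 * α)) =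
      2 ^ (β - 2 * α) * Real.Gamma (2 - β + 2 * α) * Real.sin ((2 - β + 2 * α) / 2 * π) /
          (β * (β - 1 - 2 * α)) *
        ∫ x : ℝ, ‖φ₀ x‖ ^ 2 := by
  obtain ⟨hc, ho, ⟨C, hC⟩, hint, hsq, hL⟩ := aux_g φ₀ hodd
  have htime := aux_time α β hα h1 h2 φ₀ hodd
  have hmeas : Measurable (Function.uncurry (fun x t : ℝ => gradProp1 α β φ₀ x t)) := by
    unfold Function.uncurry gradProp1
    have hgm := hc.measurable
    apply Measurable.const_mul
    apply StronglyMeasurable.measurable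
    apply StronglyMeasurable.integral_prod_right
      (f := fun (p : ℝ × ℝ) (ξ : ℝ) => ((|ξ| ^ α : ℝ) : ℂ) *
        Complex.exp (Complex.I * ((p.1 * ξ : ℝ) : ℂ)) *
        Complex.exp (-(Complex.I * (p.2 : ℂ) * ((|ξ| ^ β : ℝ) : ℂ))) *
          fourierInt1 (fun y => φ₀ y) ξ)
    apply Measurable.stronglyMeasurable
    unfold Function.uncurry
    fun_prop
  set g := fourierInt1 (fun y => φ₀ y) with hg
  have hgm := hc.measurable
  set γ := β - 2 * α with hγ
  have hβ : 0 < β := by linarith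
  set K := 2 * (2 ^ (γ - 2) * Real.Gamma (2 - γ) * Real.sin ((2 - γ) / 2 * π) / (γ - 1)) with hK
  have T1 := aux_tonelli (μ := volume.restrict (Ioi 0)) (ν := volume)
    (fun ξ x => ξ ^ (1 - γ) * ‖g ξ‖ ^ 2 * (Real.sin (x * ξ) ^ 2 / |x| ^ γ))
    (by
      apply Measurable.aestronglyMeasurable
      unfold Function.uncurry
      fun_prop)
    (by
      filter_upwards [ae_restrict_mem measurableSet_Ioi] with ξ hξ
      refine Filter.Eventually.of_forall fun w => ?_
      have : (0:ℝ) < ξ := hξ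
      positivity)
    (fun ξ => K * ‖g ξ‖ ^ 2)
    (by
      filter_upwards [ae_restrict_mem measurableSet_Ioi] with ξ hξ
      have hξ' : (0:ℝ) < ξ := hξ
      obtain ⟨a, b⟩ := aux_sin_line γ h1 h2 ξ hξ'
      refine ⟨a.const_mul _, ?_⟩
      rw [integral_const_mul, b, ← hK]
      have : ξ ^ (1 - γ) * ξ ^ (γ - 1) = 1 := by
        rw [← Real.rpow_add hξ']; simp
      linear_combination ‖g ξ‖ ^ 2 * K * this)
    (hsq.const_mul K)
  have T2 := aux_tonelli (μ := volume) (ν := volume)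
    (fun x t => ‖gradProp1 α β φ₀ x t‖ ^ 2 / |x| ^ γ)
    (by
      apply Measurable.aestronglyMeasurable
      unfold Function.uncurry at hmeas ⊢
      fun_prop)
    (by
      refine Filter.Eventually.of_forall fun x => Filter.Eventually.of_forall fun t => ?_
      positivity)
    (fun x => 2 / (π * β) * ∫ ξ in Ioi (0:ℝ),
      ξ ^ (1 - γ) * ‖g ξ‖ ^ 2 * (Real.sin (x * ξ) ^ 2 / |x| ^ γ))
    (by
      refine Filter.Eventually.of_forall fun x => ?_
      refine ⟨(htime x).1.div_const _, ?_⟩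
      rw [integral_div, (htime x).2, mul_div_assoc, ← integral_div]
      simp_rw [mul_div_assoc])
    (T1.1.const_mul _)
  rw [T2.2, integral_const_mul, T1.2, integral_const_mul, hL, hK]
  rw [show 2 - β + 2 * α = 2 - γ by rw [hγ]; ring, show β - 1 - 2 * α = γ - 1 by rw [hγ]; ring]
  have e : (2:ℝ) ^ (γ - 2) = 2 ^ γ / 4 := by
    rw [Real.rpow_sub (by norm_num)]; norm_num
  have hg1 : γ - 1 ≠ 0 := by linarith
  have := Real.pi_ne_zero
  rw [e]
  field_simp
  norm_num
end

section
/- Let φ₀ be an odd Schwartz function on ℝ (φ₀(−x) = −φ₀(x)) and let φ be the solution of the free Schrödinger equation i φ_t = −φ_{xx} in ℝ^{1+1} with φ(·,0) = φ₀. Then ∫_{−∞}^{∞} ∫_{−∞}^{∞} |φ(x,t)|² / |x|² dx dt = π ‖φ₀‖_{L²(ℝ)}². -/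
open MeasureTheory Real SchwartzMap

open FourierTransform

lemma planch {f : ℝ → ℂ} (h1 : Integrable f) (h2 : MemLp f 2) :
    ∫⁻ w, ‖𝓕 f w‖ₑ ^ 2 = ∫⁻ s, ‖f s‖ₑ ^ 2 := by
  set F : Lp (α := ℝ) ℂ 2 := h2.toLp f with hF
  have hFf : F =ᵐ[volume] f := h2.coeFn_toLp
  have hcont : Continuous (𝓕 f) :=
    VectorFourier.fourierIntegral_continuous (μ := volume) (L := innerₗ ℝ)
      Real.continuous_fourierChar continuous_inner h1
  have key : (𝓕 F : Lp ℂ 2 (volume : Measure ℝ)) =ᵐ[volume] 𝓕 f := by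
    apply ae_eq_of_integral_contDiff_smul_eq
    · exact (Lp.memLp _).locallyIntegrable (by norm_num)
    · exact hcont.locallyIntegrable (μ := volume)
    · intro g hg hgc
      let G : 𝓢(ℝ, ℂ) := HasCompactSupport.toSchwartzMap (f := fun x => (g x : ℂ))
        (hgc.comp_left (g := fun x : ℝ => (x : ℂ)) rfl) (Complex.ofRealCLM.contDiff.comp hg)
      have hG : ∀ x, G x = (g x : ℂ) := fun x => rfl
      have e1 := congrArg (fun T : 𝓢'(ℝ, ℂ) => T G) (Lp.fourier_toTemperedDistribution_eq F)
      simp only [TemperedDistribution.fourier_apply, Lp.toTemperedDistribution_apply] at e1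
      have e2 : ∫ x, (𝓕 G) x • F x = ∫ x, (𝓕 G) x • f x := by
        apply integral_congr_ae
        filter_upwards [hFf] with x hx
        rw [hx]
      have e3 : ∫ x, (𝓕 G) x • f x = ∫ x, G x • 𝓕 f x := by
        rw [SchwartzMap.fourier_coe]
        simpa using! (VectorFourier.integral_fourierIntegral_smul_eq_flip (L := innerₗ ℝ)
          (μ := volume) (ν := volume) Real.continuous_fourierChar continuous_inner
          (f := (G : ℝ → ℂ)) (g := f) G.integrable h1)
      rw [e2, e3] at e1
      simpa [hG] using e1.symm
  have n := Lp.norm_fourier_eq F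
  have n1 : eLpNorm (𝓕 f) 2 volume = eLpNorm f 2 volume := by
    rw [← eLpNorm_congr_ae key, ← eLpNorm_congr_ae hFf]
    rw [Lp.norm_def, Lp.norm_def] at n
    exact (ENNReal.toReal_eq_toReal_iff' (Lp.eLpNorm_ne_top _) (Lp.eLpNorm_ne_top _)).1 n
  rw [eLpNorm_eq_lintegral_rpow_enorm_toReal (by norm_num) (by norm_num), eLpNorm_eq_lintegral_rpow_enorm_toReal (by norm_num) (by norm_num)] at n1
  have := congrArg (fun z => z ^ (2:ℝ)) n1
  simp only [← ENNReal.rpow_mul] at this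
  simpa using this

lemma lint_scale {f : ℝ → ENNReal} (hf : Measurable f) {a : ℝ} (ha : 0 < a) :
    ∫⁻ t, f t = ENNReal.ofReal a * ∫⁻ t, f (a * t) := by
  conv_lhs => rw [← Real.smul_map_volume_mul_left ha.ne', lintegral_smul_measure,
    lintegral_map hf (by fun_prop), abs_of_pos ha]
  rfl

lemma planch2 {f : ℝ → ℂ} (h1 : Integrable f) (h2 : MemLp f 2) :
    ∫⁻ t : ℝ, ‖∫ s : ℝ, Complex.exp (-(Complex.I * ((s * t : ℝ) : ℂ))) * f s‖ₑ ^ 2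
      = ENNReal.ofReal (2 * π) * ∫⁻ s, ‖f s‖ₑ ^ 2 := by
  have hcont : Continuous (𝓕 f) :=
    VectorFourier.fourierIntegral_continuous (μ := volume) (L := innerₗ ℝ)
      Real.continuous_fourierChar continuous_inner h1
  have e : ∀ t : ℝ, ∫ s : ℝ, Complex.exp (-(Complex.I * ((s * t : ℝ) : ℂ))) * f s
      = 𝓕 f (t / (2 * π)) := by
    intro t
    rw [Real.fourier_eq']
    congr 1; ext s
    rw [smul_eq_mul]
    congr 2
    have : (π : ℂ) ≠ 0 := by exact_mod_cast Real.pi_ne_zero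
    simp
    field_simp
  simp_rw [e]
  rw [lint_scale (f := fun t => ‖𝓕 f (t / (2 * π))‖ₑ ^ 2) (a := 2 * π) ((hcont.comp (by fun_prop : Continuous fun t : ℝ => t / (2 * π))).measurable.enorm.pow_const 2) (by positivity), ← planch h1 h2]
  congr 2; ext t
  congr 4
  field_simp

lemma sinc_sq {ξ : ℝ} (hξ : 0 < ξ) :
    ∫⁻ x : ℝ, ENNReal.ofReal (sin (x * ξ) ^ 2 / x ^ 2) = ENNReal.ofReal (π * ξ) := by
  set f : ℝ → ℂ := (Set.Ioc (-ξ) ξ).indicator (fun _ => 1) with hf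
  have h1 : Integrable f := by
    rw [hf, integrable_indicator_iff measurableSet_Ioc]
    simp [IntegrableOn]
  have h2 : MemLp f 2 := by
    apply memLp_indicator_const _ measurableSet_Ioc
    right; simp
  have key := planch2 h1 h2
  have e1 : ∫⁻ s, ‖f s‖ₑ ^ 2 = ENNReal.ofReal (2 * ξ) := by
    have : ∀ s, ‖f s‖ₑ ^ 2 = (Set.Ioc (-ξ) ξ).indicator (fun _ => 1) s := by
      intro s
      by_cases h : s ∈ Set.Ioc (-ξ) ξ <;> simp [hf, h]
    simp_rw [this]
    rw [lintegral_indicator measurableSet_Ioc]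
    simp only [lintegral_const, one_mul, Measure.restrict_apply_univ, Real.volume_Ioc]; ring_nf
  have e2 : ∀ t : ℝ, t ≠ 0 → ‖∫ s : ℝ, Complex.exp (-(Complex.I * ((s * t : ℝ) : ℂ))) * f s‖ₑ ^ 2
      = ENNReal.ofReal 4 * ENNReal.ofReal (sin (t * ξ) ^ 2 / t ^ 2) := by
    intro t ht
    have e3 : ∫ s : ℝ, Complex.exp (-(Complex.I * ((s * t : ℝ) : ℂ))) * f s
        = ((2 * sin (t * ξ) / t : ℝ) : ℂ) := by
      have : ∀ s : ℝ, Complex.exp (-(Complex.I * ((s * t : ℝ) : ℂ))) * f s =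
        (Set.Ioc (-ξ) ξ).indicator (fun s : ℝ => Complex.exp ((-Complex.I * t) * s)) s := by
        intro s
        by_cases h : s ∈ Set.Ioc (-ξ) ξ
        · simp [hf, h]; congr 1; ring
        · simp [hf, h]
      simp_rw [this]
      have ht' : (t : ℂ) ≠ 0 := by exact_mod_cast ht
      rw [integral_indicator measurableSet_Ioc, ← intervalIntegral.integral_of_le (by linarith),
        integral_exp_mul_complex (by simp [ht])]
      push_cast
      rw [Complex.sin]
      field_simp
      rw [show Complex.I ^ 2 = -1 from Complex.I_sq]
      ring_nf
    rw [e3, ← ENNReal.ofReal_mul (by norm_num), ← ofReal_norm, Complex.norm_real,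
      ← ENNReal.ofReal_pow (by positivity)]
    congr 1
    rw [Real.norm_eq_abs, sq_abs]
    ring
  have e4 : ∫⁻ t : ℝ, ‖∫ s : ℝ, Complex.exp (-(Complex.I * ((s * t : ℝ) : ℂ))) * f s‖ₑ ^ 2
      = ∫⁻ t : ℝ, ENNReal.ofReal 4 * ENNReal.ofReal (sin (t * ξ) ^ 2 / t ^ 2) := by
    apply lintegral_congr_ae
    filter_upwards [Measure.ae_ne volume (0:ℝ)] with t ht using e2 t ht
  rw [e4, e1, lintegral_const_mul _ (by fun_prop), ← ENNReal.ofReal_mul (by positivity)] at key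
  rw [show 2 * π * (2 * ξ) = 4 * (π * ξ) by ring, ENNReal.ofReal_mul (by norm_num)] at key
  exact (ENNReal.mul_right_inj (by simp) (by simp)).1 key

lemma half_img : (fun ξ : ℝ => ξ ^ 2) '' Set.Ioi 0 = Set.Ioi 0 := by
  ext s
  constructor
  · rintro ⟨x, hx, rfl⟩
    have : 0 < x := hx
    exact pow_pos this 2
  · intro hs
    exact ⟨√s, Real.sqrt_pos.2 hs, Real.sq_sqrt (le_of_lt hs)⟩

lemma half_inj : Set.InjOn (fun ξ : ℝ => ξ ^ 2) (Set.Ioi 0) := by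
  intro a ha b hb h
  have ha' : 0 < a := ha
  have hb' : 0 < b := hb
  exact (pow_left_inj₀ ha'.le hb'.le two_ne_zero).1 h

lemma half_der : ∀ ξ ∈ Set.Ioi (0:ℝ), HasDerivWithinAt (fun ξ : ℝ => ξ ^ 2) (2 * ξ) (Set.Ioi 0) ξ := by
  intro ξ _
  simpa using (hasDerivAt_pow 2 ξ).hasDerivWithinAt

noncomputable def uu (g : ℝ → ℂ) (x s : ℝ) : ℂ := ((sin (x * √s) / √s : ℝ) : ℂ) * g √s

lemma uu_sq (g : ℝ → ℂ) (x : ℝ) {ξ : ℝ} (hξ : 0 < ξ) :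
    uu g x (ξ ^ 2) = ((sin (x * ξ) / ξ : ℝ) : ℂ) * g ξ := by
  simp [uu, Real.sqrt_sq hξ.le]

lemma uu_meas {g : ℝ → ℂ} (hg : Continuous g) (x : ℝ) : Measurable (uu g x) := by
  unfold uu
  have := hg.measurable
  fun_prop

lemma uu_int {g : ℝ → ℂ} (hg : Continuous g) (hi : Integrable g) (x : ℝ) :
    Integrable ((Set.Ioi 0).indicator (uu g x)) := by
  rw [integrable_indicator_iff measurableSet_Ioi]
  rw [← half_img, integrableOn_image_iff_integrableOn_abs_deriv_smul measurableSet_Ioi half_der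
    half_inj]
  have : IntegrableOn (fun ξ => 2 * (((sin (x * ξ) : ℝ) : ℂ) * g ξ)) (Set.Ioi 0) := by
    apply Integrable.const_mul
    apply Integrable.integrableOn
    refine hi.bdd_mul (c := 1) (by fun_prop) ?_
    filter_upwards with a
    rw [Complex.norm_real]
    exact Real.abs_sin_le_one _
  refine this.congr_fun ?_ measurableSet_Ioi
  intro ξ hξ
  have h0 : 0 < ξ := hξ
  have h0' : (ξ : ℂ) ≠ 0 := by exact_mod_cast h0.ne'
  simp only [uu_sq g x h0]
  rw [abs_of_pos (by positivity), Complex.real_smul]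
  push_cast
  field_simp

lemma uu_sqint {g : ℝ → ℂ} (x : ℝ) :
    ∫⁻ s, ‖(Set.Ioi 0).indicator (uu g x) s‖ₑ ^ 2 =
      ∫⁻ ξ in Set.Ioi 0, ENNReal.ofReal (2 * sin (x * ξ) ^ 2 / ξ) * ‖g ξ‖ₑ ^ 2 := by
  have : ∀ s, ‖(Set.Ioi 0).indicator (uu g x) s‖ₑ ^ 2 =
      (Set.Ioi 0).indicator (fun s => ‖uu g x s‖ₑ ^ 2) s := by
    intro s
    by_cases h : s ∈ Set.Ioi (0:ℝ)
    · rw [Set.indicator_of_mem h, Set.indicator_of_mem h]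
    · rw [Set.indicator_of_notMem h, Set.indicator_of_notMem h]; simp
  simp_rw [this]
  rw [lintegral_indicator measurableSet_Ioi]
  conv_lhs => rw [← half_img]
  rw [lintegral_image_eq_lintegral_abs_deriv_mul measurableSet_Ioi half_der half_inj]
  apply setLIntegral_congr_fun measurableSet_Ioi
  intro ξ hξ
  have h0 : 0 < ξ := hξ
  simp only [uu_sq g x h0]
  rw [enorm_mul, mul_pow, ← mul_assoc, ← ofReal_norm, ← ENNReal.ofReal_pow (by positivity),
    ← ENNReal.ofReal_mul (by positivity), Complex.norm_real, Real.norm_eq_abs, sq_abs,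
    abs_of_pos (by positivity)]
  congr 2
  field_simp

lemma uu_L2 {g : ℝ → ℂ} (hg : Continuous g) (hi : ∫⁻ ξ, ‖g ξ‖ₑ ^ 2 < ⊤) (x : ℝ) :
    MemLp ((Set.Ioi 0).indicator (uu g x)) 2 := by
  refine ⟨((uu_meas hg x).indicator measurableSet_Ioi).aestronglyMeasurable, ?_⟩
  rw [eLpNorm_lt_top_iff_lintegral_rpow_enorm_lt_top (by norm_num) (by norm_num)]
  have := uu_sqint (g := g) x
  simp only [ENNReal.toReal_ofNat, ENNReal.rpow_ofNat]
  rw [this]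
  calc _ ≤ ∫⁻ ξ in Set.Ioi 0, ENNReal.ofReal (2 * |x|) * ‖g ξ‖ₑ ^ 2 := by
        apply setLIntegral_mono' measurableSet_Ioi
        intro ξ hξ
        have h0 : 0 < ξ := hξ
        gcongr
        rw [div_le_iff₀ h0]
        have h1 : |sin (x * ξ)| ≤ |x * ξ| := Real.abs_sin_le_abs
        have h2 := Real.abs_sin_le_one (x * ξ)
        rw [abs_mul, abs_of_pos h0] at h1
        rw [← sq_abs]
        nlinarith [abs_nonneg (sin (x * ξ))]
    _ ≤ ∫⁻ ξ, ENNReal.ofReal (2 * |x|) * ‖g ξ‖ₑ ^ 2 := setLIntegral_le_lintegral _ _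
    _ = ENNReal.ofReal (2 * |x|) * ∫⁻ ξ, ‖g ξ‖ₑ ^ 2 := by
        rw [lintegral_const_mul _ (by have := hg.measurable; fun_prop)]
    _ < ⊤ := ENNReal.mul_lt_top ENNReal.ofReal_lt_top hi

noncomputable def PP (g : ℝ → ℂ) (x t : ℝ) : ℂ :=
  ∫ ξ : ℝ, Complex.exp (Complex.I * ((x * ξ : ℝ) : ℂ)) *
    Complex.exp (-(Complex.I * ((ξ ^ 2 * t : ℝ) : ℂ))) * g ξ

lemma norm_cexpI (y : ℝ) : ‖Complex.exp (Complex.I * (y : ℂ))‖ = 1 := by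
  rw [mul_comm]; exact Complex.norm_exp_ofReal_mul_I y

lemma norm_cexpI' (y : ℝ) : ‖Complex.exp (-(Complex.I * (y : ℂ)))‖ = 1 := by
  simpa using norm_cexpI (-y)

lemma PP_eq {g : ℝ → ℂ} (hi : Integrable g) (ho : ∀ ξ, g (-ξ) = - g ξ)
    (x t : ℝ) : PP g x t = Complex.I * ∫ s : ℝ, Complex.exp (-(Complex.I * ((s * t : ℝ) : ℂ))) *
      (Set.Ioi 0).indicator (uu g x) s := by
  have hint : Integrable (fun ξ : ℝ => Complex.exp (Complex.I * ((x * ξ : ℝ) : ℂ)) *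
    Complex.exp (-(Complex.I * ((ξ ^ 2 * t : ℝ) : ℂ))) * g ξ) := by
    refine hi.bdd_mul (c := 1) (by fun_prop) ?_
    filter_upwards with a
    rw [norm_mul, norm_cexpI, norm_cexpI', one_mul]
  have hint2 := hint.comp_neg
  have R : ∫ s : ℝ, Complex.exp (-(Complex.I * ((s * t : ℝ) : ℂ))) *
      (Set.Ioi 0).indicator (uu g x) s = ∫ s in Set.Ioi (0:ℝ),
      Complex.exp (-(Complex.I * ((s * t : ℝ) : ℂ))) * uu g x s := by
    rw [← integral_indicator measurableSet_Ioi]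
    congr 1; ext s
    by_cases h : s ∈ Set.Ioi (0:ℝ)
    · rw [Set.indicator_of_mem h, Set.indicator_of_mem h]
    · rw [Set.indicator_of_notMem h, Set.indicator_of_notMem h]; simp
  rw [R]
  conv_rhs => rw [← half_img]
  rw [integral_image_eq_integral_abs_deriv_smul measurableSet_Ioi half_der half_inj]
  rw [PP, ← intervalIntegral.integral_Iic_add_Ioi (b := 0) hint.integrableOn hint.integrableOn]
  have := integral_comp_neg_Iic 0 (fun ξ : ℝ => Complex.exp (Complex.I * ((x * (-ξ) : ℝ) : ℂ)) *
    Complex.exp (-(Complex.I * (((-ξ) ^ 2 * t : ℝ) : ℂ))) * g (-ξ))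
  simp only [neg_neg, neg_zero] at this
  rw [this, ← integral_add hint2.integrableOn hint.integrableOn, ← integral_const_mul]
  apply setIntegral_congr_fun measurableSet_Ioi
  intro ξ hξ
  have h0 : 0 < ξ := hξ
  have h0' : (ξ : ℂ) ≠ 0 := by exact_mod_cast h0.ne'
  simp only [uu_sq g x h0]
  rw [abs_of_pos (by positivity), Complex.real_smul, ho, neg_sq]
  push_cast
  rw [Complex.sin]
  field_simp
  rw [show Complex.I ^ 2 = -1 from Complex.I_sq]
  ring_nf

lemma PP_sq {g : ℝ → ℂ} (hg : Continuous g) (hi : Integrable g)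
    (hi2 : ∫⁻ ξ, ‖g ξ‖ₑ ^ 2 < ⊤) (ho : ∀ ξ, g (-ξ) = - g ξ) (x : ℝ) :
    ∫⁻ t, ‖PP g x t‖ₑ ^ 2 = ENNReal.ofReal (2 * π) *
      ∫⁻ ξ in Set.Ioi 0, ENNReal.ofReal (2 * sin (x * ξ) ^ 2 / ξ) * ‖g ξ‖ₑ ^ 2 := by
  rw [← uu_sqint, ← planch2 (uu_int hg hi x) (uu_L2 hg hi2 x)]
  congr 1; ext t
  rw [PP_eq hi ho, enorm_mul]
  simp [← ofReal_norm]

lemma PP_meas {g : ℝ → ℂ} (hg : Continuous g) : Measurable (fun p : ℝ × ℝ => PP g p.2 p.1) := by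
  unfold PP
  have : StronglyMeasurable (fun q : (ℝ × ℝ) × ℝ => Complex.exp (Complex.I * ((q.1.2 * q.2 : ℝ) : ℂ)) *
    Complex.exp (-(Complex.I * ((q.2 ^ 2 * q.1.1 : ℝ) : ℂ))) * g q.2) :=
    Continuous.stronglyMeasurable (by fun_prop)
  exact this.integral_prod_right'.measurable

lemma PP_main {g : ℝ → ℂ} (hg : Continuous g) (hi : Integrable g)
    (hi2 : ∫⁻ ξ, ‖g ξ‖ₑ ^ 2 < ⊤) (ho : ∀ ξ, g (-ξ) = - g ξ) :
    ∫⁻ t, ∫⁻ x, ENNReal.ofReal (1 / x ^ 2) * ‖PP g x t‖ₑ ^ 2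
      = ENNReal.ofReal (4 * π ^ 2) * ∫⁻ ξ in Set.Ioi 0, ‖g ξ‖ₑ ^ 2 := by
  have hm := PP_meas hg
  have hgm := hg.measurable
  rw [lintegral_lintegral_swap (by
    apply Measurable.aemeasurable
    exact (Measurable.ennreal_ofReal (by fun_prop)).mul (hm.enorm.pow_const 2))]
  have e1 : ∀ x : ℝ, ∫⁻ t, ENNReal.ofReal (1 / x ^ 2) * ‖PP g x t‖ₑ ^ 2 =
      ∫⁻ ξ in Set.Ioi 0, ENNReal.ofReal (4 * π * (1 / ξ)) * ‖g ξ‖ₑ ^ 2 *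
        ENNReal.ofReal (sin (x * ξ) ^ 2 / x ^ 2) := by
    intro x
    rw [lintegral_const_mul' _ _ ENNReal.ofReal_ne_top, PP_sq hg hi hi2 ho, ← mul_assoc,
      ← lintegral_const_mul' _ _ (ENNReal.mul_ne_top ENNReal.ofReal_ne_top ENNReal.ofReal_ne_top)]
    apply setLIntegral_congr_fun measurableSet_Ioi
    intro ξ hξ
    have h0 : 0 < ξ := hξ
    simp only
    rw [mul_right_comm (ENNReal.ofReal (4 * π * (1 / ξ))), ← ENNReal.ofReal_mul (by positivity),
      ← ENNReal.ofReal_mul (by positivity), ← mul_assoc, ← ENNReal.ofReal_mul (by positivity)]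
    congr 2
    ring
  simp_rw [e1]
  rw [lintegral_lintegral_swap (by
    apply Measurable.aemeasurable
    fun_prop)]
  rw [← lintegral_const_mul' _ _ ENNReal.ofReal_ne_top]
  apply setLIntegral_congr_fun measurableSet_Ioi
  intro ξ hξ
  have h0 : 0 < ξ := hξ
  simp only
  rw [lintegral_const_mul _ (by fun_prop), sinc_sq h0, mul_right_comm,
    ← ENNReal.ofReal_mul (by positivity)]
  congr 2
  field_simp

lemma half_sq {g : ℝ → ℂ} (ho : ∀ ξ, g (-ξ) = - g ξ) :
    ∫⁻ ξ, ‖g ξ‖ₑ ^ 2 = 2 * ∫⁻ ξ in Set.Ioi 0, ‖g ξ‖ₑ ^ 2 := by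
  rw [← lintegral_add_compl _ (measurableSet_Ioi (a := (0:ℝ))), two_mul]
  congr 1
  rw [Set.compl_Ioi, ← restrict_Iio_eq_restrict_Iic]
  have := (Measure.measurePreserving_neg (volume : Measure ℝ)).setLIntegral_comp_preimage_emb
    (MeasurableEquiv.neg ℝ).measurableEmbedding (fun ξ => ‖g ξ‖ₑ ^ 2) (Set.Ioi 0)
  rw [← this]
  simp [ho]

lemma gradProp_eq (φ₀ : 𝓢(ℝ, ℂ)) (x t : ℝ) :
    gradProp1 0 2 φ₀ x t = ((2 * π : ℝ))⁻¹ * PP (fourierInt1 (fun y => φ₀ y)) x t := by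
  unfold gradProp1 PP
  congr 1
  congr 1; ext ξ
  rw [Real.rpow_zero, Real.rpow_two, sq_abs]
  push_cast
  ring_nf

lemma fourierInt1_eq (f : ℝ → ℂ) (ξ : ℝ) : fourierInt1 f ξ = 𝓕 f (ξ / (2 * π)) := by
  unfold fourierInt1
  rw [Real.fourier_eq']
  congr 1; ext s
  rw [smul_eq_mul]
  congr 2
  have : (π : ℂ) ≠ 0 := by exact_mod_cast Real.pi_ne_zero
  simp
  field_simp



/-- Sharp Kato smoothing identity for the free 1-d Schrödinger equation with odd data:
`∫∫ |φ(x,t)|²/|x|² dx dt = π ‖φ₀‖₂²`. -/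
theorem kato_identity_free_schrodinger_odd_1d
    (φ₀ : SchwartzMap ℝ ℂ) (hodd : ∀ x : ℝ, φ₀ (-x) = -φ₀ x) :
    (∫ t : ℝ, ∫ x : ℝ, ‖gradProp1 0 2 φ₀ x t‖ ^ 2 / |x| ^ (2 : ℝ)) =
      π * ∫ x : ℝ, ‖φ₀ x‖ ^ 2 := by
  
  set g : ℝ → ℂ := fourierInt1 (fun y => φ₀ y) with hgdef
  have hgS : g = fun ξ => (𝓕 φ₀ : 𝓢(ℝ, ℂ)) (ξ / (2 * π)) := by
    ext ξ
    rw [hgdef, fourierInt1_eq, SchwartzMap.fourier_coe]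
  have hg : Continuous g := by
    rw [hgS]
    exact (𝓕 φ₀ : 𝓢(ℝ, ℂ)).continuous.comp (by fun_prop)
  have hi : Integrable g := by
    rw [hgS]
    exact (𝓕 φ₀ : 𝓢(ℝ, ℂ)).integrable.comp_div (by positivity)
  have ho : ∀ ξ, g (-ξ) = - g ξ := by
    intro ξ
    simp only [hgdef, fourierInt1]
    rw [← integral_neg_eq_self, ← integral_neg]
    congr 1; ext y
    rw [hodd]
    simp
  have hL : MemLp (fun y => φ₀ y) 2 := φ₀.memLp 2
  have hpl : ∫⁻ ξ, ‖g ξ‖ₑ ^ 2 = ENNReal.ofReal (2 * π) * ∫⁻ y, ‖φ₀ y‖ₑ ^ 2 :=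
    planch2 φ₀.integrable hL
  have hφi : Integrable (fun y => ‖φ₀ y‖ ^ 2) :=
    (memLp_two_iff_integrable_sq_norm φ₀.continuous.aestronglyMeasurable).1 hL
  have hφ : ∫⁻ y, ‖φ₀ y‖ₑ ^ 2 = ENNReal.ofReal (∫ y, ‖φ₀ y‖ ^ 2) := by
    rw [ofReal_integral_eq_lintegral_ofReal hφi (by filter_upwards with y; positivity)]
    congr 1; ext y
    rw [← ofReal_norm, ENNReal.ofReal_pow (by positivity)]
  have hn : 0 ≤ ∫ y, ‖φ₀ y‖ ^ 2 := by positivity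
  rw [hφ, ← ENNReal.ofReal_mul (by positivity)] at hpl
  have hi2 : ∫⁻ ξ, ‖g ξ‖ₑ ^ 2 < ⊤ := by rw [hpl]; exact ENNReal.ofReal_lt_top
  have hhalf : ∫⁻ ξ in Set.Ioi 0, ‖g ξ‖ₑ ^ 2 = ENNReal.ofReal (π * ∫ y, ‖φ₀ y‖ ^ 2) := by
    have h := half_sq ho
    rw [hpl, mul_assoc, ENNReal.ofReal_mul (by norm_num)] at h
    simp only [ENNReal.ofReal_ofNat] at h
    exact ((ENNReal.mul_right_inj (by simp) (by simp)).1 h).symm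
  have hmain := PP_main hg hi hi2 ho
  rw [hhalf] at hmain
  have hpt : ∀ t x : ℝ, ENNReal.ofReal (‖gradProp1 0 2 φ₀ x t‖ ^ 2 / |x| ^ (2 : ℝ)) =
      ENNReal.ofReal ((4 * π ^ 2)⁻¹) * (ENNReal.ofReal (1 / x ^ 2) * ‖PP g x t‖ₑ ^ 2) := by
    intro t x
    rw [gradProp_eq, ← hgdef, ← ofReal_norm, ← ENNReal.ofReal_pow (by positivity),
      ← ENNReal.ofReal_mul (by positivity), ← ENNReal.ofReal_mul (by positivity),
      Real.rpow_two, sq_abs, norm_mul, mul_pow]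
    congr 1
    rw [Complex.norm_real, Real.norm_eq_abs, sq_abs]
    ring
  have htot : ∫⁻ t, ∫⁻ x, ENNReal.ofReal (‖gradProp1 0 2 φ₀ x t‖ ^ 2 / |x| ^ (2 : ℝ)) =
      ENNReal.ofReal (π * ∫ y, ‖φ₀ y‖ ^ 2) := by
    simp_rw [hpt, lintegral_const_mul' _ _ ENNReal.ofReal_ne_top]
    rw [hmain, ← mul_assoc, ← ENNReal.ofReal_mul (by positivity),
      inv_mul_cancel₀ (by positivity), ENNReal.ofReal_one, one_mul]
  have hmeas : Measurable (fun p : ℝ × ℝ => ‖gradProp1 0 2 φ₀ p.2 p.1‖ ^ 2 / |p.2| ^ (2 : ℝ)) := by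
    have e : ∀ p : ℝ × ℝ, gradProp1 0 2 φ₀ p.2 p.1 = ((2 * π : ℝ))⁻¹ * PP g p.2 p.1 :=
      fun p => gradProp_eq φ₀ p.2 p.1
    simp_rw [e]
    have := PP_meas hg
    fun_prop
  have hnn : ∀ p : ℝ × ℝ, 0 ≤ ‖gradProp1 0 2 φ₀ p.2 p.1‖ ^ 2 / |p.2| ^ (2 : ℝ) := by
    intro p; positivity
  have hprod : ∫⁻ p : ℝ × ℝ, ENNReal.ofReal (‖gradProp1 0 2 φ₀ p.2 p.1‖ ^ 2 / |p.2| ^ (2 : ℝ)) =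
      ENNReal.ofReal (π * ∫ y, ‖φ₀ y‖ ^ 2) := by
    rw [← htot, Measure.volume_eq_prod, lintegral_prod _ hmeas.ennreal_ofReal.aemeasurable]
  have hint : Integrable (fun p : ℝ × ℝ => ‖gradProp1 0 2 φ₀ p.2 p.1‖ ^ 2 / |p.2| ^ (2 : ℝ)) := by
    rw [← lintegral_ofReal_ne_top_iff_integrable hmeas.aestronglyMeasurable
      (Filter.Eventually.of_forall hnn), hprod]
    exact ENNReal.ofReal_ne_top
  rw [Measure.volume_eq_prod] at hint
  have := integral_prod _ hint
  simp only at this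
  rw [← this, ← Measure.volume_eq_prod, integral_eq_lintegral_of_nonneg_ae
    (Filter.Eventually.of_forall hnn) hmeas.aestronglyMeasurable, hprod,
    ENNReal.toReal_ofReal (by positivity)]
end

section
/- Let β ∈ ℝ with β > −1 and β ≠ 0. Then there exists a constant C = C(β) such that for every Schwartz function φ₀ on ℝ, the solution φ of i φ_t = (−Δ)^{β/2} φ in ℝ^{1+1} with φ(·,0) = φ₀ satisfies sup_{x ∈ ℝ} ∫_{−∞}^{∞} | |∇|^{(β−1)/2} φ(x,t) |² dt ≤ C ‖φ₀‖_{L²(ℝ)}². -/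
open MeasureTheory Real SchwartzMap

section KPV
open Set FourierTransform
open scoped ContDiff

lemma kpv_norm_sq_Lp (F : Lp (α := ℝ) ℂ 2 volume) : ‖F‖ ^ 2 = ∫ t, ‖F t‖ ^ 2 := by
  apply Complex.ofRealLI.injective
  have h := L2.inner_def (𝕜 := ℂ) F F
  rw [inner_self_eq_norm_sq_to_K] at h
  simpa [← LinearIsometry.integral_comp_comm, inner_self_eq_norm_sq_to_K] using h

lemma kpv_fourier_ae (g : ℝ → ℂ) (hg : Integrable g) (hg2 : MemLp g 2) :
    𝓕 g =ᵐ[volume] (𝓕 (hg2.toLp g) : Lp (α := ℝ) ℂ 2 volume) := by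
  have hcont : Continuous (𝓕 g) :=
    VectorFourier.fourierIntegral_continuous continuous_fourierChar (L := innerₗ ℝ)
      continuous_inner hg
  refine ae_eq_of_integral_contDiff_smul_eq hcont.locallyIntegrable
    ((Lp.memLp _).locallyIntegrable (by norm_num)) ?_
  intro φ hφ hφs
  have hφc : HasCompactSupport (fun x => (φ x : ℂ)) := hφs.comp_left (g := fun r : ℝ => (r : ℂ)) rfl
  have hφd : ContDiff ℝ ∞ (fun x => (φ x : ℂ)) := Complex.ofRealCLM.contDiff.comp hφ
  let ψ : 𝓢(ℝ, ℂ) := hφc.toSchwartzMap hφd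
  have hψ : ∀ x, ψ x = (φ x : ℂ) := fun x => rfl
  have h1 := Lp.fourier_toTemperedDistribution_eq (hg2.toLp g)
  have h2 := congrArg (fun T => T ψ) h1
  simp only [TemperedDistribution.fourier_apply, Lp.toTemperedDistribution_apply] at h2
  have h3 := VectorFourier.integral_fourierIntegral_smul_eq_flip (L := innerₗ ℝ) (μ := volume)
    (ν := volume) continuous_fourierChar continuous_inner ψ.integrable hg
  have h4 : ∫ x, (𝓕 ψ) x • (hg2.toLp g) x = ∫ x, (𝓕 ψ) x • g x := by
    apply integral_congr_ae
    filter_upwards [MemLp.coeFn_toLp hg2] with x hx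
    rw [hx]
  have h5 : ∫ x, (𝓕 ψ) x • g x = ∫ x, ψ x • (𝓕 g) x := by
    rw [flip_innerₗ] at h3
    exact h3
  calc ∫ x, φ x • (𝓕 g) x = ∫ x, ψ x • (𝓕 g) x := by simp [hψ]
    _ = ∫ x, ψ x • (𝓕 (hg2.toLp g) : Lp (α := ℝ) ℂ 2 volume) x := by rw [← h5, ← h4, h2]
    _ = _ := by simp [hψ]

lemma kpv_plancherel (g : ℝ → ℂ) (hg : Integrable g) (hg2 : MemLp g 2) :
    ∫ t, ‖(𝓕 g : ℝ → ℂ) t‖ ^ 2 = ∫ t, ‖g t‖ ^ 2 := by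
  have h1 : ∫ t, ‖(𝓕 g : ℝ → ℂ) t‖ ^ 2 = ∫ t, ‖(𝓕 (hg2.toLp g) : Lp (α := ℝ) ℂ 2 volume) t‖ ^ 2 := by
    apply integral_congr_ae
    filter_upwards [kpv_fourier_ae g hg hg2] with x hx
    rw [hx]
  have h2 : ∫ t, ‖g t‖ ^ 2 = ∫ t, ‖(hg2.toLp g : Lp (α := ℝ) ℂ 2 volume) t‖ ^ 2 := by
    apply integral_congr_ae
    filter_upwards [MemLp.coeFn_toLp hg2] with x hx
    rw [hx]
  rw [h1, h2, ← kpv_norm_sq_Lp, ← kpv_norm_sq_Lp, Lp.norm_fourier_eq]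

lemma kpv_fourier_scale (g : ℝ → ℂ) (t : ℝ) :
    ∫ s : ℝ, Complex.exp (-(Complex.I * t * s)) * g s = 𝓕 g (t / (2 * π)) := by
  rw [fourier_real_eq_integral_exp_smul]
  refine integral_congr_ae (Filter.Eventually.of_forall fun s => ?_)
  simp only
  rw [smul_eq_mul]
  congr 2
  have : (π : ℂ) ≠ 0 := by exact_mod_cast pi_ne_zero
  push_cast
  field_simp

lemma kpv_fourierInt1 (φ : 𝓢(ℝ, ℂ)) (ξ : ℝ) :
    fourierInt1 (fun y => φ y) ξ = (𝓕 φ) (ξ / (2 * π)) := by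
  rw [SchwartzMap.fourier_coe, ← kpv_fourier_scale]
  unfold fourierInt1
  refine integral_congr_ae (Filter.Eventually.of_forall fun s => ?_)
  simp only
  congr 3
  push_cast; ring

lemma kpv_scale (f : ℝ → ℂ) :
    ∫ t, ‖f (t / (2 * π))‖ ^ 2 = (2 * π) * ∫ t, ‖f t‖ ^ 2 := by
  rw [Measure.integral_comp_div (fun t => ‖f t‖ ^ 2), abs_of_pos (by positivity), smul_eq_mul]

lemma kpv_half (β : ℝ) (hβ' : β ≠ 0) (h : ℝ → ℂ)
    (h1 : IntegrableOn (fun ξ => ((ξ ^ ((β - 1) / 2) : ℝ) : ℂ) * h ξ) (Ioi 0))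
    (h2 : IntegrableOn (fun ξ => ‖h ξ‖ ^ 2) (Ioi 0)) :
    ∫ t : ℝ, ‖∫ ξ in Ioi (0:ℝ), ((ξ ^ ((β - 1) / 2) : ℝ) : ℂ) *
      Complex.exp (-(Complex.I * (t : ℂ) * ((ξ ^ β : ℝ) : ℂ))) * h ξ‖ ^ 2
      = (2 * π) * (|β|⁻¹ * ∫ ξ in Ioi (0:ℝ), ‖h ξ‖ ^ 2) := by
  set α := (β - 1) / 2 with hα
  let g0 : ℝ → ℂ := fun s => ((|β|⁻¹ * s ^ ((α - β + 1) / β) : ℝ) : ℂ) * h (s ^ (1 / β))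
  have hb : |β| ≠ 0 := abs_ne_zero.mpr hβ'
  have key : ∀ ξ ∈ Ioi (0:ℝ), g0 (ξ ^ β) = ((|β|⁻¹ * ξ ^ (α - β + 1) : ℝ) : ℂ) * h ξ := by
    intro ξ hξ
    have hξ : 0 < ξ := hξ
    simp only [g0]
    rw [← rpow_mul hξ.le, ← rpow_mul hξ.le, mul_one_div_cancel hβ', rpow_one,
      mul_div_cancel₀ _ hβ']
  have key1 : ∀ ξ ∈ Ioi (0:ℝ), (|β| * ξ ^ (β - 1)) * (|β|⁻¹ * ξ ^ (α - β + 1)) = ξ ^ α := by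
    intro ξ hξ
    have e : ξ ^ α = ξ ^ (β - 1) * ξ ^ (α - β + 1) := by
      rw [← rpow_add hξ]; congr 1; ring
    rw [e]; field_simp
  have key2 : ∀ ξ ∈ Ioi (0:ℝ), (|β| * ξ ^ (β - 1)) * (|β|⁻¹ * ξ ^ (α - β + 1)) ^ 2 = |β|⁻¹ := by
    intro ξ hξ
    have hξ : 0 < ξ := hξ
    rw [sq, ← mul_assoc, key1 ξ hξ]
    have e : ξ ^ α * ξ ^ (α - β + 1) = 1 := by
      rw [← rpow_add hξ, hα, show (β - 1) / 2 + ((β - 1) / 2 - β + 1) = 0 by ring, rpow_zero]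
    rw [mul_left_comm, e, mul_one]
  have hg1 : IntegrableOn g0 (Ioi 0) := by
    rw [← integrableOn_Ioi_comp_rpow_iff g0 hβ']
    refine h1.congr_fun ?_ measurableSet_Ioi
    intro ξ hξ
    simp only
    rw [key ξ hξ, Complex.real_smul, ← mul_assoc, ← Complex.ofReal_mul, key1 ξ hξ]
  have n2 : ∀ ξ ∈ Ioi (0:ℝ), (|β| * ξ ^ (β - 1)) • ‖g0 (ξ ^ β)‖ ^ 2 = |β|⁻¹ * ‖h ξ‖ ^ 2 := by
    intro ξ hξ
    rw [key ξ hξ, norm_mul, mul_pow, Complex.norm_real, norm_eq_abs, sq_abs, smul_eq_mul,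
      ← mul_assoc, key2 ξ hξ]
  have hg2 : IntegrableOn (fun s => ‖g0 s‖ ^ 2) (Ioi 0) := by
    rw [← integrableOn_Ioi_comp_rpow_iff _ hβ']
    refine IntegrableOn.congr_fun (h2.const_mul |β|⁻¹) ?_ measurableSet_Ioi
    intro ξ hξ
    exact (n2 ξ hξ).symm
  have hI2 : ∫ s in Ioi (0:ℝ), ‖g0 s‖ ^ 2 = |β|⁻¹ * ∫ ξ in Ioi (0:ℝ), ‖h ξ‖ ^ 2 := by
    rw [← integral_comp_rpow_Ioi _ hβ', ← integral_const_mul]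
    exact setIntegral_congr_fun measurableSet_Ioi n2
  let g : ℝ → ℂ := (Ioi 0).indicator g0
  have hgi : Integrable g := hg1.integrable_indicator measurableSet_Ioi
  have hsq : (fun s => ‖g s‖ ^ 2) = (Ioi 0).indicator (fun s => ‖g0 s‖ ^ 2) := by
    ext s
    by_cases hs : s ∈ Ioi (0:ℝ) <;> simp only [g, indicator, hs, if_true, if_false] <;> simp
  have hgm : MemLp g 2 := by
    rw [memLp_two_iff_integrable_sq_norm hgi.1, hsq]
    exact hg2.integrable_indicator measurableSet_Ioi
  have hmain : ∀ t : ℝ, ∫ ξ in Ioi (0:ℝ), ((ξ ^ α : ℝ) : ℂ) *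
      Complex.exp (-(Complex.I * (t : ℂ) * ((ξ ^ β : ℝ) : ℂ))) * h ξ = 𝓕 g (t / (2 * π)) := by
    intro t
    rw [← kpv_fourier_scale]
    have : (fun s : ℝ => Complex.exp (-(Complex.I * t * s)) * g s)
        = (Ioi 0).indicator (fun s : ℝ => Complex.exp (-(Complex.I * t * s)) * g0 s) := by
      ext s
      by_cases hs : s ∈ Ioi (0:ℝ) <;> simp only [g, indicator, hs, if_true, if_false] <;> simp
    rw [this, integral_indicator measurableSet_Ioi, ← integral_comp_rpow_Ioi
      (fun s : ℝ => Complex.exp (-(Complex.I * t * s)) * g0 s) hβ']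
    refine setIntegral_congr_fun measurableSet_Ioi ?_
    intro ξ hξ
    simp only
    rw [key ξ hξ, Complex.real_smul, ← key1 ξ hξ]
    push_cast
    ring
  simp_rw [hmain]
  rw [kpv_scale, kpv_plancherel g hgi hgm, hsq, integral_indicator measurableSet_Ioi, hI2]


end KPV

/-- Kenig–Ponce–Vega local smoothing: for `β > -1`, `β ≠ 0`,
`sup_x ∫ | |∇|^{(β-1)/2} φ(x,t) |² dt ≤ C ‖φ₀‖₂²`. -/
theorem kenig_ponce_vega_local_smoothing_1d (β : ℝ) (hβ : -1 < β) (hβ' : β ≠ 0) :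
    ∃ C : ℝ, ∀ φ₀ : SchwartzMap ℝ ℂ, ∀ x : ℝ,
      (∫ t : ℝ, ‖gradProp1 ((β - 1) / 2) β φ₀ x t‖ ^ 2) ≤
        C * ∫ y : ℝ, ‖φ₀ y‖ ^ 2 := by
  refine ⟨2 / |β|, fun φ₀ x => ?_⟩
  have hb : 0 < |β| := abs_pos.mpr hβ'
  have hF : ∀ ξ, fourierInt1 (fun y => φ₀ y) ξ = (FourierTransform.fourier φ₀ : 𝓢(ℝ, ℂ)) (ξ / (2 * π)) :=
    kpv_fourierInt1 φ₀
  set F : ℝ → ℂ := fourierInt1 (fun y => φ₀ y) with hFdef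
  have hFc : Continuous F := by
    have : F = fun ξ => (FourierTransform.fourier φ₀ : 𝓢(ℝ, ℂ)) (ξ / (2 * π)) := funext hF
    rw [this]
    exact (SchwartzMap.continuous _).comp (by fun_prop)
  have hFi : Integrable (fun ξ => ‖F ξ‖ ^ 2) := by
    have h1 : Integrable (fun ξ => ‖(FourierTransform.fourier φ₀ : 𝓢(ℝ, ℂ)) ξ‖ ^ 2) :=
      (memLp_two_iff_integrable_sq_norm (SchwartzMap.continuous _).aestronglyMeasurable).1
        ((FourierTransform.fourier φ₀ : 𝓢(ℝ, ℂ)).memLp 2)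
    have h2 := h1.comp_div (R := 2 * π) (by positivity)
    simpa only [hF] using h2
  have hFn : ∫ ξ, ‖F ξ‖ ^ 2 = 2 * π * ∫ y, ‖φ₀ y‖ ^ 2 := by
    simp only [hF]
    rw [kpv_scale, SchwartzMap.integral_norm_sq_fourier]
  have hnn : 0 ≤ ∫ y, ‖φ₀ y‖ ^ 2 := integral_nonneg fun y => by positivity
  have he : ∀ r : ℝ, ‖Complex.exp (Complex.I * (r : ℂ))‖ = 1 := fun r => by
    rw [mul_comm]; exact Complex.norm_exp_ofReal_mul_I r
  have he' : ∀ t r : ℝ, ‖Complex.exp (-(Complex.I * (t : ℂ) * (r : ℂ)))‖ = 1 := fun t r => by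
    have := he (-(t * r))
    rw [← this]; congr 2; push_cast; ring
  set α := (β - 1) / 2 with hα
  let G : ℝ → ℝ → ℂ := fun t ξ => ((|ξ| ^ α : ℝ) : ℂ) * Complex.exp (Complex.I * ((x * ξ : ℝ) : ℂ)) *
        Complex.exp (-(Complex.I * (t : ℂ) * ((|ξ| ^ β : ℝ) : ℂ))) * F ξ
  have hGm : ∀ t, Measurable (G t) := by
    intro t
    have := hFc.measurable
    simp only [G]
    fun_prop
  have hgp : ∀ t, gradProp1 α β φ₀ x t = ((2 * π : ℝ) : ℂ)⁻¹ * ∫ ξ, G t ξ := fun t => by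
    simp [gradProp1, G, hFdef]
  have hGn : ∀ t ξ, ‖G t ξ‖ = ‖((|ξ| ^ α : ℝ) : ℂ) * F ξ‖ := by
    intro t ξ
    simp only [G, norm_mul, he, he', mul_one]
  by_cases hI : Integrable (fun ξ => ((|ξ| ^ α : ℝ) : ℂ) * F ξ)
  swap
  · have h0 : ∀ t, gradProp1 α β φ₀ x t = 0 := by
      intro t
      rw [hgp, integral_undef, mul_zero]
      intro hG
      apply hI
      refine hG.mono ?_ (Filter.Eventually.of_forall fun ξ => (hGn t ξ).ge)
      have := hFc.measurable
      exact Measurable.aestronglyMeasurable (by fun_prop)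
    simp only [h0]
    simp only [norm_zero, ne_eq, OfNat.ofNat_ne_zero, not_false_eq_true, zero_pow, integral_zero]
    positivity
  have hGi : ∀ t, Integrable (G t) := fun t =>
    hI.mono (hGm t).aestronglyMeasurable (Filter.Eventually.of_forall fun ξ => (hGn t ξ).le)
  let h : ℝ → ℂ := fun ξ => Complex.exp (Complex.I * ((x * ξ : ℝ) : ℂ)) * F ξ +
    Complex.exp (Complex.I * ((x * (-ξ) : ℝ) : ℂ)) * F (-ξ)
  have hsplit : ∀ t ξ : ℝ, ξ ∈ Set.Ioi (0:ℝ) → G t ξ + G t (-ξ) = ((ξ ^ α : ℝ) : ℂ) *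
      Complex.exp (-(Complex.I * (t : ℂ) * ((ξ ^ β : ℝ) : ℂ))) * h ξ := by
    intro t ξ hξ
    simp only [G, h, abs_neg, abs_of_pos (show 0 < ξ from hξ)]
    ring
  have hGint : ∀ t, ∫ ξ, G t ξ = ∫ ξ in Set.Ioi (0:ℝ), ((ξ ^ α : ℝ) : ℂ) *
      Complex.exp (-(Complex.I * (t : ℂ) * ((ξ ^ β : ℝ) : ℂ))) * h ξ := by
    intro t
    rw [← setIntegral_congr_fun measurableSet_Ioi (hsplit t),
      integral_add (hGi t).integrableOn (hGi t).comp_neg.integrableOn,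
      integral_comp_neg_Ioi, neg_zero, add_comm,
      intervalIntegral.integral_Iic_add_Ioi (hGi t).integrableOn (hGi t).integrableOn]
  have h1 : IntegrableOn (fun ξ => ((ξ ^ α : ℝ) : ℂ) * h ξ) (Set.Ioi 0) := by
    have := ((hGi 0).add (hGi 0).comp_neg).integrableOn (s := Set.Ioi 0)
    refine IntegrableOn.congr_fun this ?_ measurableSet_Ioi
    intro ξ hξ
    have := hsplit 0 ξ hξ
    simpa using this
  have hhn : ∀ ξ, ‖h ξ‖ ^ 2 ≤ 2 * (‖F ξ‖ ^ 2 + ‖F (-ξ)‖ ^ 2) := by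
    intro ξ
    have h3 : ‖h ξ‖ ≤ ‖F ξ‖ + ‖F (-ξ)‖ := by
      refine (norm_add_le _ _).trans (le_of_eq ?_)
      rw [norm_mul, norm_mul, he, he, one_mul, one_mul]
    nlinarith [norm_nonneg (h ξ), sq_nonneg (‖F ξ‖ - ‖F (-ξ)‖), norm_nonneg (F ξ), norm_nonneg (F (-ξ))]
  have hdom : Integrable (fun ξ => 2 * (‖F ξ‖ ^ 2 + ‖F (-ξ)‖ ^ 2)) :=
    (hFi.add hFi.comp_neg).const_mul 2
  have hhc : Continuous h := by simp only [h]; fun_prop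
  have h2 : IntegrableOn (fun ξ => ‖h ξ‖ ^ 2) (Set.Ioi 0) := by
    refine (hdom.mono' (hhc.norm.pow 2).aestronglyMeasurable
      (Filter.Eventually.of_forall fun ξ => ?_)).integrableOn
    change ‖‖h ξ‖ ^ 2‖ ≤ _
    rw [norm_of_nonneg (sq_nonneg _)]
    exact hhn ξ
  have hle : ∫ ξ in Set.Ioi (0:ℝ), ‖h ξ‖ ^ 2 ≤ 2 * ∫ ξ, ‖F ξ‖ ^ 2 := by
    calc ∫ ξ in Set.Ioi (0:ℝ), ‖h ξ‖ ^ 2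
        ≤ ∫ ξ in Set.Ioi (0:ℝ), 2 * (‖F ξ‖ ^ 2 + ‖F (-ξ)‖ ^ 2) :=
          setIntegral_mono h2 hdom.integrableOn hhn
      _ = 2 * ∫ ξ, ‖F ξ‖ ^ 2 := by
          rw [integral_const_mul, integral_add hFi.integrableOn hFi.comp_neg.integrableOn,
            integral_comp_neg_Ioi (f := fun ξ => ‖F ξ‖ ^ 2), neg_zero, add_comm,
            intervalIntegral.integral_Iic_add_Ioi hFi.integrableOn hFi.integrableOn]
  have hfin := kpv_half β hβ' h h1 h2
  simp only [hgp, hGint, norm_mul, mul_pow]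
  rw [integral_const_mul, hfin, norm_inv, Complex.norm_real, norm_of_nonneg (show 0 ≤ 2 * π by positivity)]
  rw [hFn] at hle
  calc ((2 * π)⁻¹) ^ 2 * (2 * π * (|β|⁻¹ * ∫ ξ in Set.Ioi (0:ℝ), ‖h ξ‖ ^ 2))
      ≤ ((2 * π)⁻¹) ^ 2 * (2 * π * (|β|⁻¹ * (2 * (2 * π * ∫ y, ‖φ₀ y‖ ^ 2)))) := by gcongr
    _ = 2 / |β| * ∫ y, ‖φ₀ y‖ ^ 2 := by
      have := pi_pos
      field_simp
end

section
/- For every s with 1 < s < 2 and every real number a ≠ 0, ∫_{−∞}^{∞} (1 − cos(a x)) / |x|^{s} dx = [ 2 Γ(2−s) sin( (2−s)π/2 ) / (s−1) ] |a|^{s−1}. -/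
open MeasureTheory Real

lemma aux_swap (f : ℝ → ℝ → ℝ) (hm : Measurable (Function.uncurry f))
    (h0 : ∀ x, 0 < x → ∀ t, 0 < t → 0 ≤ f x t)
    (h1 : ∀ x, 0 < x → IntegrableOn (fun t => f x t) (Set.Ioi 0))
    (h2 : ∀ t, 0 < t → IntegrableOn (fun x => f x t) (Set.Ioi 0)) :
    ∫ x in Set.Ioi (0:ℝ), ∫ t in Set.Ioi (0:ℝ), f x t =
      ∫ t in Set.Ioi (0:ℝ), ∫ x in Set.Ioi (0:ℝ), f x t := by
  rw [integral_eq_lintegral_of_nonneg_ae, integral_eq_lintegral_of_nonneg_ae]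
  · congr 1
    have e1 : ∫⁻ x in Set.Ioi (0:ℝ), ENNReal.ofReal (∫ t in Set.Ioi (0:ℝ), f x t) =
        ∫⁻ x in Set.Ioi (0:ℝ), ∫⁻ t in Set.Ioi (0:ℝ), ENNReal.ofReal (f x t) := by
      refine setLIntegral_congr_fun measurableSet_Ioi fun x hx => ?_
      refine ofReal_integral_eq_lintegral_ofReal (h1 x hx) ?_
      filter_upwards [ae_restrict_mem measurableSet_Ioi] with t ht using h0 x hx t ht
    have e2 : ∫⁻ t in Set.Ioi (0:ℝ), ENNReal.ofReal (∫ x in Set.Ioi (0:ℝ), f x t) =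
        ∫⁻ t in Set.Ioi (0:ℝ), ∫⁻ x in Set.Ioi (0:ℝ), ENNReal.ofReal (f x t) := by
      refine setLIntegral_congr_fun measurableSet_Ioi fun t ht => ?_
      refine ofReal_integral_eq_lintegral_ofReal (h2 t ht) ?_
      filter_upwards [ae_restrict_mem measurableSet_Ioi] with x hx using h0 x hx t ht
    rw [e1, e2]
    exact lintegral_lintegral_swap (ENNReal.measurable_ofReal.comp hm).aemeasurable
  · filter_upwards [ae_restrict_mem measurableSet_Ioi] with t ht
    exact setIntegral_nonneg measurableSet_Ioi fun x hx => h0 x hx t ht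
  · exact (hm.stronglyMeasurable.integral_prod_left).aestronglyMeasurable
  · filter_upwards [ae_restrict_mem measurableSet_Ioi] with x hx
    exact setIntegral_nonneg measurableSet_Ioi fun t ht => h0 x hx t ht
  · exact (hm.stronglyMeasurable.integral_prod_right).aestronglyMeasurable

lemma aux_beta_s8 (q : ℝ) (hq : -1 < q) (hq' : q < 1) :
    ∫ t in Set.Ioi (0:ℝ), t ^ q / (1 + t ^ 2) =
      1 / 2 * Real.Gamma ((q + 1) / 2) * Real.Gamma (1 - (q + 1) / 2) := by
  have hfac : ∀ t u : ℝ, t ^ q * exp (-(1 + t ^ 2) * u) =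
      exp (-u) * (t ^ q * exp (-u * t ^ 2)) := by
    intro t u
    rw [show -(1 + t ^ 2) * u = -u + -u * t ^ 2 by ring, exp_add]; ring
  have key := aux_swap (fun t u => t ^ q * exp (-(1 + t ^ 2) * u)) (by unfold Function.uncurry; fun_prop)
    (fun t ht u hu => by positivity)
    (fun t ht => (integrableOn_exp_mul_Ioi (by nlinarith [sq_nonneg t]) 0).const_mul _)
    (fun u hu => by
      simp_rw [hfac]
      exact (integrableOn_rpow_mul_exp_neg_mul_sq hu hq).const_mul _)
  have l1 : ∫ t in Set.Ioi (0:ℝ), ∫ u in Set.Ioi (0:ℝ), t ^ q * exp (-(1 + t ^ 2) * u) =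
      ∫ t in Set.Ioi (0:ℝ), t ^ q / (1 + t ^ 2) := by
    refine setIntegral_congr_fun measurableSet_Ioi fun t ht => ?_
    rw [integral_const_mul, integral_exp_mul_Ioi (by nlinarith [sq_nonneg t])]
    simp [neg_div_neg_eq, div_eq_mul_inv, ← inv_neg, -neg_add_rev]
  have l2 : ∫ u in Set.Ioi (0:ℝ), ∫ t in Set.Ioi (0:ℝ), t ^ q * exp (-(1 + t ^ 2) * u) =
      ∫ u in Set.Ioi (0:ℝ), 1 / 2 * Real.Gamma ((q + 1) / 2) *
        (exp (-u) * u ^ ((1 - (q + 1) / 2) - 1)) := by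
    refine setIntegral_congr_fun measurableSet_Ioi fun u hu => ?_
    simp_rw [hfac]
    rw [integral_const_mul]
    have := integral_rpow_mul_exp_neg_mul_rpow (p := 2) two_pos hq hu
    simp_rw [rpow_two] at this
    rw [this, show (1 - (q + 1) / 2) - 1 = -(q+1)/2 by ring]
    ring
  rw [← l1, key, l2, integral_const_mul, Real.Gamma_eq_integral (s := 1 - (q+1)/2) (by linarith)]

lemma aux_lap (t : ℝ) (ht : 0 < t) :
    IntegrableOn (fun x => (1 - cos x) * exp (-(x * t))) (Set.Ioi 0) ∧
    ∫ x in Set.Ioi (0:ℝ), (1 - cos x) * exp (-(x * t)) = 1 / (t * (1 + t ^ 2)) := by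
  have hre : ((-t + Complex.I : ℂ)).re < 0 := by simpa using ht
  have i1 := integrableOn_exp_mul_Ioi (a := -t) (by linarith) 0
  have i2 := integrableOn_exp_mul_complex_Ioi hre 0
  have v2 := integral_exp_mul_complex_Ioi hre 0
  have hr : ∀ x : ℝ, (Complex.exp ((-t + Complex.I) * x)).re = exp (-t * x) * cos x := by
    intro x
    simp [Complex.exp_re]
  have i3 : IntegrableOn (fun x : ℝ => exp (-t * x) * cos x) (Set.Ioi 0) := by
    have := i2.re
    simpa only [RCLike.re_to_complex, hr] using! this
  have v3 : ∫ x in Set.Ioi (0:ℝ), exp (-t * x) * cos x = t / (1 + t ^ 2) := by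
    simp_rw [← hr, ← RCLike.re_to_complex]
    rw [integral_re i2, v2]
    simp [Complex.div_re, Complex.normSq_apply]
    ring
  have he : (fun x => (1 - cos x) * exp (-(x * t))) =
      fun x => exp (-t * x) - exp (-t * x) * cos x := by
    funext x
    rw [show -(x * t) = -t * x by ring]; ring
  rw [he]
  refine ⟨i1.sub i3, ?_⟩
  rw [integral_sub i1 i3, v3, integral_exp_mul_Ioi (by linarith)]
  have : 1 + t ^ 2 ≠ 0 := by positivity
  simp
  field_simp
  ring

lemma aux_half_s8 (s : ℝ) (hs1 : 1 < s) (hs2 : s < 2) :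
    ∫ x in Set.Ioi (0:ℝ), (1 - cos x) / x ^ s =
      Real.Gamma (2 - s) * Real.sin ((2 - s) * π / 2) / (s - 1) := by
  have hs0 : 0 < s := by linarith
  have hG : Real.Gamma s ≠ 0 := (Real.Gamma_pos_of_pos hs0).ne'
  have hfac : ∀ x t : ℝ, (1 - cos x) * (t ^ (s - 1) * exp (-(x * t))) =
      t ^ (s - 1) * ((1 - cos x) * exp (-(x * t))) := by intros; ring
  have key := aux_swap (fun x t => (1 - cos x) * (t ^ (s - 1) * exp (-(x * t))))
    (by unfold Function.uncurry; fun_prop)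
    (fun x hx t ht => mul_nonneg (by linarith [cos_le_one x]) (by positivity))
    (fun x hx => by
      refine Integrable.const_mul ?_ _
      have := integrableOn_rpow_mul_exp_neg_mul_rpow (p := 1) (s := s - 1) (b := x)
        (by linarith) one_pos hx
      simpa [IntegrableOn] using this)
    (fun t ht => by
      simp_rw [hfac]
      exact (aux_lap t ht).1.const_mul _)
  have l1 : ∫ x in Set.Ioi (0:ℝ), ∫ t in Set.Ioi (0:ℝ),
      (1 - cos x) * (t ^ (s - 1) * exp (-(x * t))) =
      ∫ x in Set.Ioi (0:ℝ), Real.Gamma s * ((1 - cos x) / x ^ s) := by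
    refine setIntegral_congr_fun measurableSet_Ioi fun x hx => ?_
    rw [integral_const_mul, integral_rpow_mul_exp_neg_mul_Ioi hs0 hx, one_div,
      inv_rpow (le_of_lt hx)]
    ring
  have l2 : ∫ t in Set.Ioi (0:ℝ), ∫ x in Set.Ioi (0:ℝ),
      (1 - cos x) * (t ^ (s - 1) * exp (-(x * t))) =
      ∫ t in Set.Ioi (0:ℝ), t ^ (s - 2) / (1 + t ^ 2) := by
    refine setIntegral_congr_fun measurableSet_Ioi fun t ht => ?_
    have ht' : 0 < t := ht
    simp_rw [hfac]
    rw [integral_const_mul, (aux_lap t ht).2, show s - 1 = (s - 2) + 1 by ring,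
      rpow_add_one ht'.ne']
    have : 1 + t ^ 2 ≠ 0 := by positivity
    field_simp
  rw [l1, l2, integral_const_mul, aux_beta_s8 _ (by linarith) (by linarith), mul_assoc,
    Real.Gamma_mul_Gamma_one_sub] at key
  have g1 : Real.Gamma s = (s - 1) * Real.Gamma (s - 1) := by
    have := Real.Gamma_add_one (s := s - 1) (by linarith)
    simpa using this
  have g2 := Real.Gamma_mul_Gamma_one_sub (s - 1)
  rw [show 1 - (s - 1) = 2 - s by ring, show π * (s - 1) = 2 * (π * ((s - 2 + 1) / 2)) by ring,
    sin_two_mul] at g2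
  have g3 : sin ((2 - s) * π / 2) = cos (π * ((s - 2 + 1) / 2)) := by
    rw [← sin_pi_div_two_sub]; congr 1; ring
  have hpi := pi_pos
  have p1 : 0 < sin (π * ((s - 2 + 1) / 2)) :=
    sin_pos_of_pos_of_lt_pi (by apply mul_pos hpi; linarith) (by nlinarith)
  have p2 : 0 < cos (π * ((s - 2 + 1) / 2)) :=
    cos_pos_of_mem_Ioo ⟨by nlinarith, by nlinarith⟩
  rw [g3]
  apply mul_left_cancel₀ hG
  rw [key, g1]
  have hs : s - 1 ≠ 0 := by linarith
  generalize sin (π * ((s - 2 + 1) / 2)) = S at *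
  generalize cos (π * ((s - 2 + 1) / 2)) = C at *
  have : (s - 1) * Real.Gamma (s - 1) * (Real.Gamma (2 - s) * C / (s - 1)) =
      (Real.Gamma (s - 1) * Real.Gamma (2 - s)) * C := by
    field_simp
  rw [this, g2]
  field_simp

/-- For `1 < s < 2` and `a ≠ 0`,
`∫ (1 - cos (a x)) / |x|^s dx = (2 Γ(2-s) sin((2-s)π/2) / (s-1)) |a|^{s-1}`. -/
theorem integral_one_sub_cos_div_abs_rpow (s : ℝ) (hs1 : 1 < s) (hs2 : s < 2)
    (a : ℝ) (ha : a ≠ 0) :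
    (∫ x : ℝ, (1 - Real.cos (a * x)) / |x| ^ s) =
      2 * Real.Gamma (2 - s) * Real.sin ((2 - s) * π / 2) / (s - 1) * |a| ^ (s - 1) := by
  have ha' : 0 < |a| := abs_pos.mpr ha
  have h1 : ∀ x : ℝ, (1 - Real.cos (a * x)) / |x| ^ s =
      |a| ^ s * ((fun y : ℝ => (1 - Real.cos |y|) / |y| ^ s) (a * x)) := by
    intro x
    have : |a| ^ s ≠ 0 := (rpow_pos_of_pos ha' s).ne'
    simp only [cos_abs]
    rw [abs_mul, mul_rpow (abs_nonneg _) (abs_nonneg _), mul_div_assoc', mul_div_mul_left _ _ this]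
  simp_rw [h1]
  rw [integral_const_mul, Measure.integral_comp_mul_left (fun y : ℝ => (1 - Real.cos |y|) / |y| ^ s) a,
    integral_comp_abs (f := fun y => (1 - Real.cos y) / y ^ s), aux_half_s8 s hs1 hs2,
    rpow_sub_one ha'.ne', abs_inv, smul_eq_mul]
  ring
end
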